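/- Let (𝔻ⁿ,σ), n ≥ 2, be the flat disk and, for j ≥ 2, define f_j radially on [0,1] × 𝔻ⁿ by f_j(r) = j for r ∈ [0, 1/j], f_j(r) = h_j(r) for r ∈ [1/j, 3/(2j)] where h_j is any decreasing continuous function with h_j(1/j) = j, h_j(3/(2j)) = 1 and ∫_{1/j}^{3/(2j)} h_j dr ≤ C/j, and f_j(r) = 1 otherwise; set g_j = −dt² + f_j²σ and g₀ = −dt² + σ. Let M = ([0,1] × 𝔻ⁿ, d̂_{t,g_j}), let N₁ and N₂ each be ([0,1] × 𝔻ⁿ, d̂_{t,g₀}), and let (P, d₀) be the quotient of the disjoint union N₁ ⊔ N₂ obtained by identifying [0,1] × ∂𝔻ⁿ ⊂ N₁ with [0,1] × {0} ⊂ N₂ via projection of the second factor. Then (M, d̂_{t,g_j}) does not converge to ([0,1] × 𝔻ⁿ, d̂_{t,g₀}), but converges in the Gromov–Hausdorff sense to (P, d₀). -/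

import Mathlib

open Set MeasureTheory Filter Topology

namespace NullDistPaper

variable {S : Type*} [PseudoMetricSpace S]

/-- A future-directed causal piece of a curve in the warped product spacetime
`([t₀,t₁] × S, -dt² + f(t,x)² σ)`, parametrized by the time coordinate on `[a,b]`:
the spatial part `x` is continuous, and its σ-length (total variation) over any
subinterval is at most the corresponding integral of `1/f` along the curve. -/
def FutureCausalPiece (f : ℝ → S → ℝ) (x : ℝ → S) (a b : ℝ) : Prop :=
  a ≤ b ∧ ContinuousOn x (Set.Icc a b) ∧
    ∀ c ∈ Set.Icc a b, ∀ d ∈ Set.Icc a b, c ≤ d →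
      eVariationOn x (Set.Icc c d) ≤ ENNReal.ofReal (∫ t in c..d, 1 / f t (x t))

/-- `q` lies in the causal future of `p`, i.e. there is a future-directed causal
curve from `p` to `q`. -/
def FutureRelated (f : ℝ → S → ℝ) (p q : ℝ × S) : Prop :=
  p.1 ≤ q.1 ∧ ∃ x : ℝ → S, x p.1 = p.2 ∧ x q.1 = q.2 ∧ FutureCausalPiece f x p.1 q.1

/-- `q ∈ J^±(p)` : `q` is causally related to `p`. -/
def CausallyRelated (f : ℝ → S → ℝ) (p q : ℝ × S) : Prop :=
  FutureRelated f p q ∨ FutureRelated f q p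

/-- A piecewise causal curve in `[t₀,t₁] × S` from `p` to `q`, recorded by its
breakpoints; consecutive breakpoints are joined by a future- or past-directed
causal piece. -/
structure PiecewiseCausal (f : ℝ → S → ℝ) (t₀ t₁ : ℝ) (p q : ℝ × S) where
  k : ℕ
  hk : 0 < k
  pt : ℕ → ℝ × S
  h0 : pt 0 = p
  hlast : pt k = q
  hstrip : ∀ i ≤ k, (pt i).1 ∈ Set.Icc t₀ t₁
  piece : ∀ i < k, CausallyRelated f (pt i) (pt (i + 1))

/-- The null length of a piecewise causal curve with respect to the
time function `τ`. -/
noncomputable def nullLength (τ : ℝ × S → ℝ) {f : ℝ → S → ℝ} {t₀ t₁ : ℝ} {p q : ℝ × S}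
    (γ : PiecewiseCausal f t₀ t₁ p q) : ℝ :=
  ∑ i ∈ Finset.range γ.k, |τ (γ.pt (i + 1)) - τ (γ.pt i)|

/-- The null distance on `[t₀,t₁] × S` for the warped product `-dt² + f(t,x)²σ`
and the time function `τ`. -/
noncomputable def nullDist (f : ℝ → S → ℝ) (τ : ℝ × S → ℝ) (t₀ t₁ : ℝ) (p q : ℝ × S) : ℝ :=
  sInf {L : ℝ | ∃ γ : PiecewiseCausal f t₀ t₁ p q, L = nullLength τ γ}

/-- Warping function depending only on the time coordinate. -/
def tWarp (f : ℝ → ℝ) : ℝ → S → ℝ := fun t _ => f t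

/-- The metric of `S` is intrinsic (a length metric): any two points can be
joined by continuous curves of length arbitrarily close to their distance.
This encodes that `(S, d)` comes from a (continuous) Riemannian metric. -/
def IsLengthSpace (S : Type*) [PseudoMetricSpace S] : Prop :=
  ∀ x y : S, ∀ ε > 0, ∃ γ : ℝ → S, γ 0 = x ∧ γ 1 = y ∧ ContinuousOn γ (Set.Icc 0 1) ∧
    eVariationOn γ (Set.Icc 0 1) ≤ ENNReal.ofReal (dist x y + ε)

end NullDistPaper

open NullDistPaper Set Filter
open scoped ENNReal

namespace NullDistPaper

/-- The flat unit disk `𝔻ⁿ ⊆ ℝⁿ` (with its flat, i.e. Euclidean, metric). -/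
abbrev Disk (n : ℕ) : Type := (Metric.closedBall (0 : EuclideanSpace ℝ (Fin n)) 1 : Set _)

/-- The unit interval `[0,1] ⊆ ℝ` as a type. -/
abbrev T01 : Type := (Set.Icc (0 : ℝ) 1 : Set ℝ)

/-- The inclusion `[0,1] × 𝔻ⁿ ↪ ℝ × 𝔻ⁿ`. -/
def emb {n : ℕ} (a : T01 × Disk n) : ℝ × Disk n := ((a.1 : ℝ), a.2)

/-- The null distance of the Minkowski product `g₀ = -dt² + σ` on `[0,1] × 𝔻ⁿ`. -/
noncomputable def dMink {n : ℕ} (a b : T01 × Disk n) : ℝ :=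
  nullDist (tWarp fun _ => (1 : ℝ)) (fun p => p.1) 0 1 (emb a) (emb b)

/-- The centre of the disk. -/
def center (n : ℕ) : Disk n := ⟨0, Metric.mem_closedBall_self zero_le_one⟩

/-- The disjoint union `N₁ ⊔ N₂` of two copies of `[0,1] × 𝔻ⁿ`. -/
abbrev BubbleZ (n : ℕ) : Type := (T01 × Disk n) ⊕ (T01 × Disk n)

/-- The identification `F : [0,1] × ∂𝔻ⁿ ⊆ N₁ → [0,1] × {0} ⊆ N₂`,
`F(t,x) = (t,0)`, as a relation on `N₁ ⊔ N₂` (together with equality). -/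
def bubbleIdent {n : ℕ} : BubbleZ n → BubbleZ n → Prop := fun z w =>
  z = w ∨
  (∃ (t : T01) (x : Disk n), ‖(x : EuclideanSpace ℝ (Fin n))‖ = 1 ∧
    z = Sum.inl (t, x) ∧ w = Sum.inr (t, center n)) ∨
  (∃ (t : T01) (x : Disk n), ‖(x : EuclideanSpace ℝ (Fin n))‖ = 1 ∧
    w = Sum.inl (t, x) ∧ z = Sum.inr (t, center n))

/-- The distance on the disjoint union before identification: the null distance
`d̂_{t,g₀}` on each copy, `∞` across the two copies. -/
noncomputable def bubbleBase {n : ℕ} : BubbleZ n → BubbleZ n → ℝ≥0∞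
  | Sum.inl a, Sum.inl b => ENNReal.ofReal (dMink a b)
  | Sum.inr a, Sum.inr b => ENNReal.ofReal (dMink a b)
  | _, _ => ⊤

/-- The quotient (semi-)metric `d₀` on `P = (N₁ ⊔ N₂)/∼` (in the sense of
Burago–Burago–Ivanov, Definition 3.1.12): the infimum of lengths of chains
passing through identified points. -/
noncomputable def bubbleQuotDist {n : ℕ} (u v : BubbleZ n) : ℝ :=
  (⨅ (k : ℕ) (z : ℕ → BubbleZ n) (_ : z 0 = u) (_ : z (2 * k + 1) = v)
      (_ : ∀ i < k, bubbleIdent (z (2 * i + 1)) (z (2 * i + 2))),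
      ∑ i ∈ Finset.range (k + 1), bubbleBase (z (2 * i)) (z (2 * i + 1))).toReal

/-- `(Xⱼ, dⱼ) → (Y, d_Y)` in the Gromov–Hausdorff sense: for every `ε > 0`,
eventually there is a correspondence between `Xⱼ` and `Y` with distortion at
most `ε` (i.e. `d_GH((Xⱼ,dⱼ),(Y,d_Y)) → 0`). -/
def GHConvergesTo {X Y : Type*} (dj : ℕ → X → X → ℝ) (dY : Y → Y → ℝ) : Prop :=
  ∀ ε > 0, ∃ N : ℕ, ∀ j ≥ N, ∃ R : Set (X × Y),
    (∀ x, ∃ y, (x, y) ∈ R) ∧ (∀ y, ∃ x, (x, y) ∈ R) ∧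
    ∀ a ∈ R, ∀ b ∈ R, |dj j a.1 b.1 - dY a.2 b.2| ≤ ε

end NullDistPaper

namespace NullDistPaper

section gen

def Adm {S : Type*} [PseudoMetricSpace S] (g : S → ℝ) : Prop := Continuous g ∧ ∀ x, 1 ≤ g x

def Gd {S : Type*} [PseudoMetricSpace S] (g : S → ℝ) (γ : ℝ → S) : Prop :=
  ∀ c d, c ≤ d → dist (γ c) (γ d) ≤ ∫ t in c..d, 1 / g (γ t)

def E {S : Type*} [PseudoMetricSpace S] (g : S → ℝ) (L : ℝ) (x y : S) : Prop :=
  0 ≤ L ∧ ∃ γ : ℝ → S, Gd g γ ∧ γ 0 = x ∧ γ L = y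

def Z {S : Type*} [PseudoMetricSpace S] (g : S → ℝ) (p q : ℝ × S) (l : ℝ) : Prop :=
  ∃ γ : PiecewiseCausal (fun _ => g) 0 1 p q, nullLength (fun p => p.1) γ ≤ l

variable {S : Type*} [PseudoMetricSpace S] {g : S → ℝ}

lemma Gd.lip (hg : Adm g) {γ : ℝ → S} (h : Gd g γ) {c d : ℝ} (hcd : c ≤ d) :
    dist (γ c) (γ d) ≤ d - c := by
  refine (h c d hcd).trans ((le_abs_self _).trans ?_)
  have := intervalIntegral.norm_integral_le_of_norm_le_const (a := c) (b := d) (C := 1)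
    (f := fun t => 1 / g (γ t)) (fun t _ => by
      have h1 := hg.2 (γ t)
      rw [Real.norm_eq_abs, abs_of_nonneg (by positivity)]
      rw [div_le_one (by linarith)]; exact h1)
  rw [Real.norm_eq_abs, one_mul, abs_of_nonneg (sub_nonneg.2 hcd)] at this
  exact this

lemma Gd.cont (hg : Adm g) {γ : ℝ → S} (h : Gd g γ) : Continuous γ := by
  have : LipschitzWith 1 γ := by
    refine LipschitzWith.of_dist_le_mul fun c d => ?_
    rw [NNReal.coe_one, one_mul, Real.dist_eq]
    rcases le_total c d with hcd | hcd
    · rw [abs_sub_comm, abs_of_nonneg (sub_nonneg.2 hcd)]; exact h.lip hg hcd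
    · rw [dist_comm, abs_of_nonneg (sub_nonneg.2 hcd)]; exact h.lip hg hcd
  exact this.continuous

lemma Gd.icont (hg : Adm g) {γ : ℝ → S} (h : Gd g γ) : Continuous fun t => 1 / g (γ t) :=
  continuous_const.div (hg.1.comp (h.cont hg)) fun t => by have := hg.2 (γ t); linarith

lemma inv_nn (hg : Adm g) (x : S) : 0 ≤ 1 / g x := by
  have := hg.2 x; positivity

lemma Gd.shift {γ : ℝ → S} (h : Gd g γ) (a : ℝ) : Gd g (fun t => γ (t + a)) := by
  intro c d hcd
  rw [intervalIntegral.integral_comp_add_right (fun t => 1 / g (γ t)) a]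
  exact h _ _ (by linarith)

lemma Gd.rev {γ : ℝ → S} (h : Gd g γ) (a : ℝ) : Gd g (fun t => γ (a - t)) := by
  intro c d hcd
  rw [intervalIntegral.integral_comp_sub_left (fun t => 1 / g (γ t)) a, dist_comm]
  exact h _ _ (by linarith)

lemma Gd.concat (hg : Adm g) {γ δ : ℝ → S} (h : Gd g γ) (h' : Gd g δ) {m : ℝ} (hm : γ m = δ m) :
    Gd g (fun t => if t ≤ m then γ t else δ t) := by
  have key1 : ∀ c d, c ≤ d → d ≤ m → (∫ t in c..d, 1 / g (if t ≤ m then γ t else δ t))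
      = ∫ t in c..d, 1 / g (γ t) := by
    intro c d hcd hd
    apply intervalIntegral.integral_congr
    intro t ht
    rw [uIcc_of_le hcd] at ht
    simp only [if_pos (ht.2.trans hd)]
  have key2 : ∀ c d, c ≤ d → m ≤ c → (∫ t in c..d, 1 / g (if t ≤ m then γ t else δ t))
      = ∫ t in c..d, 1 / g (δ t) := by
    intro c d hcd hd
    apply intervalIntegral.integral_congr
    intro t ht
    rw [uIcc_of_le hcd] at ht
    by_cases htm : t ≤ m
    · have : t = m := le_antisymm htm (hd.trans ht.1)
      subst this
      simp [hm]
    · simp only [if_neg htm]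
  have e2 : ∀ t, m ≤ t → (if t ≤ m then γ t else δ t) = δ t := by
    intro t ht
    split_ifs with h1
    · rw [le_antisymm h1 ht, hm]
    · rfl
  intro c d hcd
  beta_reduce
  rcases le_total d m with hd | hd
  · rw [key1 c d hcd hd, if_pos hd, if_pos (hcd.trans hd)]; exact h _ _ hcd
  rcases le_total m c with hc | hc
  · rw [key2 c d hcd hc, e2 c hc, e2 d hd]; exact h' _ _ hcd
  have hcont : Continuous (fun t => if t ≤ m then γ t else δ t) :=
    Continuous.if_le (h.cont hg) (h'.cont hg) continuous_id continuous_const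
      (by rintro x rfl; exact hm)
  have hc2 : Continuous fun t => 1 / g (if t ≤ m then γ t else δ t) :=
    continuous_const.div (hg.1.comp hcont) fun t => by
      have := hg.2 (if t ≤ m then γ t else δ t); exact ne_of_gt (by linarith)
  rw [← intervalIntegral.integral_add_adjacent_intervals (hc2.intervalIntegrable c m)
    (hc2.intervalIntegrable m d), key1 c m hc le_rfl, key2 m d hd le_rfl]
  rw [if_pos hc, e2 d hd]
  refine (dist_triangle _ (γ m) _).trans (add_le_add (h _ _ hc) ?_)
  rw [hm]; exact h' _ _ hd

lemma E.const (hg : Adm g) {L : ℝ} (hL : 0 ≤ L) (x : S) : E g L x x :=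
  ⟨hL, fun _ => x, fun c d hcd => by
    rw [dist_self]
    exact intervalIntegral.integral_nonneg hcd fun t _ => inv_nn hg _, rfl, rfl⟩

lemma E.symm {L : ℝ} {x y : S} (h : E g L x y) : E g L y x := by
  obtain ⟨hL, γ, h1, h2, h3⟩ := h
  exact ⟨hL, _, h1.rev L, by simpa using h3, by simpa using h2⟩

lemma E.trans (hg : Adm g) {L M : ℝ} {x y z : S} (h : E g L x y) (h' : E g M y z) :
    E g (L + M) x z := by
  obtain ⟨hL, γ, h1, h2, h3⟩ := h
  obtain ⟨hM, δ, k1, k2, k3⟩ := h'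
  have := Gd.concat hg h1 (k1.shift (-L)) (m := L) (by simp [k2, h3])
  refine ⟨by linarith, _, this, by simp [hL, h2], ?_⟩
  rcases hM.eq_or_lt with rfl | hM
  · simp [h3, ← k3, k2]
  · simp [hM.not_ge, k3]

lemma E.mono (hg : Adm g) {L M : ℝ} {x y : S} (h : E g L x y) (hLM : L ≤ M) : E g M x y := by
  have := h.trans hg (E.const hg (sub_nonneg.2 hLM) y)
  simpa using this

lemma E.split {L M : ℝ} (hL : 0 ≤ L) (hM : 0 ≤ M) {x z : S} (h : E g (L + M) x z) :
    ∃ y, E g L x y ∧ E g M y z := by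
  obtain ⟨_, γ, h1, h2, h3⟩ := h
  exact ⟨γ L, ⟨hL, γ, h1, h2, rfl⟩, ⟨hM, _, h1.shift L, by simp, by simpa [add_comm] using h3⟩⟩

lemma E.future (hg : Adm g) {L : ℝ} {x y : S} (h : E g L x y) {t s : ℝ} (hs : s = t + L) :
    FutureRelated (fun _ => g) (t, x) (s, y) := by
  obtain ⟨hL, γ, h1, h2, h3⟩ := h
  subst hs
  refine ⟨by simpa using hL, fun u => γ (u + -t), by simp [h2], by simp [h3], by simpa using hL,
    ((h1.shift (-t)).cont hg).continuousOn, ?_⟩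
  have h1' := h1.shift (-t)
  generalize (fun u => γ (u + -t)) = δ at h1'
  intro c _ d _ hcd
  have hii := fun a b => (h1'.icont hg).intervalIntegrable (μ := MeasureTheory.volume) a b
  have hI : ∀ a b, (∫ t in c..b, 1 / g (δ t)) - (∫ t in c..a, 1 / g (δ t))
      = ∫ t in a..b, 1 / g (δ t) := fun a b =>
    intervalIntegral.integral_interval_sub_left (hii _ _) (hii _ _)
  have hmono : Monotone fun b => ∫ t in c..b, 1 / g (δ t) := by
    intro a b hab
    have := hI a b
    have h0 : 0 ≤ ∫ t in a..b, 1 / g (δ t) :=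
      intervalIntegral.integral_nonneg hab fun t _ => inv_nn hg _
    simp only
    linarith
  have hle : eVariationOn δ (Set.Icc c d)
      ≤ eVariationOn (fun b => ∫ t in c..b, 1 / g (δ t)) (Set.Icc c d) := by
    unfold eVariationOn
    refine iSup_mono fun p => Finset.sum_le_sum fun i _ => ?_
    have hp : (p.2 : ℕ → ℝ) i ≤ (p.2 : ℕ → ℝ) (i + 1) := p.2.2.1 (Nat.le_succ i)
    rw [edist_dist, edist_dist]
    apply ENNReal.ofReal_le_ofReal
    rw [dist_comm, Real.dist_eq, hI]
    exact (h1' _ _ hp).trans (le_abs_self _)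
  refine hle.trans ?_
  have := (hmono.monotoneOn (Set.Icc c d)).eVariationOn_eq (a := c) (b := d)
    (left_mem_Icc.2 hcd) (right_mem_Icc.2 hcd)
  rw [Set.inter_self] at this
  refine this.le.trans (le_of_eq ?_)
  simp

lemma Z.single {p q : ℝ × S} (hp : p.1 ∈ Icc (0:ℝ) 1) (hq : q.1 ∈ Icc (0:ℝ) 1)
    (h : CausallyRelated (fun _ => g) p q) : Z g p q |q.1 - p.1| := by
  refine ⟨⟨1, one_pos, fun i => if i = 0 then p else q, by simp, by simp, ?_, ?_⟩, ?_⟩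
  · intro i _
    by_cases h : i = 0 <;> simp [h, hp.1, hp.2, hq.1, hq.2]
  · intro i hi
    have : i = 0 := by omega
    subst this
    simpa using h
  · simp [nullLength]

lemma Z.trans {p q r : ℝ × S} {l m : ℝ} (h : Z g p q l) (h' : Z g q r m) : Z g p r (l + m) := by
  obtain ⟨a, ha⟩ := h
  obtain ⟨b, hb⟩ := h'
  have e2 : ∀ i, (if a.k + i ≤ a.k then a.pt (a.k + i) else b.pt (a.k + i - a.k)) = b.pt i := by
    intro i
    by_cases hi : i = 0
    · subst hi; simp [a.hlast, b.h0]
    · rw [if_neg (by omega)]; congr 1; omega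
  refine ⟨⟨a.k + b.k, by have := a.hk; omega, fun i => if i ≤ a.k then a.pt i else b.pt (i - a.k),
    by simp [a.h0], by rw [e2, b.hlast], ?_, ?_⟩, ?_⟩
  · intro i hi
    split_ifs with h
    · exact a.hstrip i h
    · exact b.hstrip _ (by omega)
  · intro i hi
    by_cases h : i < a.k
    · rw [if_pos h.le, if_pos (by omega)]; exact a.piece i h
    · obtain ⟨i, rfl⟩ := Nat.exists_eq_add_of_le (not_lt.1 h)
      rw [e2, add_assoc, e2]; exact b.piece i (by omega)
  · unfold nullLength at ha hb ⊢
    simp only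
    rw [Finset.sum_range_add]
    refine add_le_add (le_trans (le_of_eq ?_) ha) (le_trans (le_of_eq ?_) hb)
    · refine Finset.sum_congr rfl fun i hi => ?_
      have := Finset.mem_range.1 hi
      rw [if_pos this.le, if_pos (by omega)]
    · refine Finset.sum_congr rfl fun i hi => ?_
      rw [e2, add_assoc, e2]

lemma Z.mono {p q : ℝ × S} {l m : ℝ} (h : Z g p q l) (hlm : l ≤ m) : Z g p q m := by
  obtain ⟨a, ha⟩ := h
  exact ⟨a, ha.trans hlm⟩

lemma E.zdir (hg : Adm g) {t s L : ℝ} (ht : t ∈ Icc (0:ℝ) 1) (hs : s ∈ Icc (0:ℝ) 1) {x y : S}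
    (hL : |t - s| = L) (h : E g L x y) : Z g (t, x) (s, y) L := by
  have : Z g (t, x) (s, y) |s - t| := by
    refine Z.single ht hs ?_
    rcases le_total t s with h' | h'
    · rw [abs_sub_comm, abs_of_nonneg (by linarith)] at hL
      exact Or.inl (h.future hg (by linarith))
    · rw [abs_of_nonneg (by linarith)] at hL
      exact Or.inr (h.symm.future hg (by linarith))
  rw [abs_sub_comm, hL] at this
  exact this

lemma E.zhalf (hg : Adm g) {t L : ℝ} (ht : t ∈ Icc (0:ℝ) 1) (hL1 : L ≤ 1) {x y : S}
    (h : E g L x y) : Z g (t, x) (t, y) L := by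
  have hL := h.1
  rw [← add_halves L] at h
  obtain ⟨z, h1, h2⟩ := h.split (by linarith) (by linarith)
  rw [← add_halves L]
  rcases le_total t (1/2) with h' | h'
  · have hs : t + L / 2 ∈ Icc (0:ℝ) 1 := ⟨by linarith [ht.1], by linarith⟩
    exact (h1.zdir hg ht hs (by rw [abs_sub_comm, abs_of_nonneg] <;> linarith)).trans
      (h2.zdir hg hs ht (by rw [abs_of_nonneg] <;> linarith))
  · have hs : t - L / 2 ∈ Icc (0:ℝ) 1 := ⟨by linarith [ht.1], by linarith [ht.2]⟩
    exact (h1.zdir hg ht hs (by rw [abs_of_nonneg] <;> linarith)).trans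
      (h2.zdir hg hs ht (by rw [abs_sub_comm, abs_of_nonneg] <;> linarith))

lemma E.zsame (hg : Adm g) {t : ℝ} (ht : t ∈ Icc (0:ℝ) 1) (k : ℕ) : ∀ {L : ℝ} {x y : S},
    L ≤ k + 1 → E g L x y → Z g (t, x) (t, y) L := by
  induction k with
  | zero => intro L x y h1 h; exact h.zhalf hg ht (by simpa using h1)
  | succ k ih =>
    intro L x y h1 h
    push_cast at h1
    rcases le_total L 1 with h' | h'
    · exact h.zhalf hg ht h'
    · have e : L = 1 + (L - 1) := by ring
      rw [e] at h ⊢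
      obtain ⟨z, k1, k2⟩ := h.split zero_le_one (by linarith)
      exact (k1.zhalf hg ht le_rfl).trans (ih (by linarith) k2)

lemma E.z (hg : Adm g) {t s L : ℝ} (ht : t ∈ Icc (0:ℝ) 1) (hs : s ∈ Icc (0:ℝ) 1) {x y : S}
    (h : E g L x y) : Z g (t, x) (s, y) (max |t - s| L) := by
  rcases le_total L |t - s| with h' | h'
  · rw [max_eq_left h']
    exact (h.mono hg h').zdir hg ht hs rfl
  · rw [max_eq_right h']
    have e : L = (L - |t - s|) + |t - s| := by ring
    rw [e] at h ⊢
    obtain ⟨z, k1, k2⟩ := h.split (by linarith) (abs_nonneg _)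
    obtain ⟨k, hk⟩ := exists_nat_ge (L - |t - s|)
    exact (k1.zsame hg ht k (by linarith)).trans (k2.zdir hg ht hs rfl)

lemma nullDist_le {p q : ℝ × S} {l : ℝ} (h : Z g p q l) :
    nullDist (fun _ => g) (fun p => p.1) 0 1 p q ≤ l := by
  obtain ⟨γ, h⟩ := h
  refine le_trans (csInf_le ⟨0, ?_⟩ ⟨γ, rfl⟩) h
  rintro _ ⟨γ, rfl⟩
  exact Finset.sum_nonneg fun i _ => abs_nonneg _

lemma le_nullDist {p q : ℝ × S} {l a : ℝ} (h : Z g p q l)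
    (ha : ∀ γ : PiecewiseCausal (fun _ => g) 0 1 p q, a ≤ nullLength (fun p => p.1) γ) :
    a ≤ nullDist (fun _ => g) (fun p => p.1) 0 1 p q := by
  obtain ⟨γ, _⟩ := h
  refine le_csInf ⟨_, γ, rfl⟩ ?_
  rintro _ ⟨γ, rfl⟩
  exact ha γ

lemma len_time {p q : ℝ × S} (γ : PiecewiseCausal (fun _ => g) 0 1 p q) :
    |p.1 - q.1| ≤ nullLength (fun p => p.1) γ := by
  have := dist_le_range_sum_dist (fun i => (γ.pt i).1) γ.k
  rw [γ.h0, γ.hlast, Real.dist_eq] at this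
  refine this.trans (le_of_eq ?_)
  unfold nullLength
  refine Finset.sum_congr rfl fun i _ => ?_
  rw [dist_comm, Real.dist_eq]

lemma len_psi {β : Type*} [PseudoMetricSpace β] (ψ : S → β)
    (hψ : ∀ p q : ℝ × S, FutureRelated (fun _ => g) p q → dist (ψ p.2) (ψ q.2) ≤ q.1 - p.1)
    {p q : ℝ × S} (γ : PiecewiseCausal (fun _ => g) 0 1 p q) :
    dist (ψ p.2) (ψ q.2) ≤ nullLength (fun p => p.1) γ := by
  have := dist_le_range_sum_dist (fun i => ψ (γ.pt i).2) γ.k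
  rw [γ.h0, γ.hlast] at this
  refine this.trans ?_
  unfold nullLength
  refine Finset.sum_le_sum fun i hi => ?_
  rcases γ.piece i (Finset.mem_range.1 hi) with h | h
  · exact (hψ _ _ h).trans (le_abs_self _)
  · rw [dist_comm, abs_sub_comm]; exact (hψ _ _ h).trans (le_abs_self _)

/-- basic sandwich -/
lemma nd_upper (hg : Adm g) {t s L : ℝ} (ht : t ∈ Icc (0:ℝ) 1) (hs : s ∈ Icc (0:ℝ) 1) {x y : S}
    (h : E g L x y) :
    nullDist (fun _ => g) (fun p => p.1) 0 1 (t, x) (s, y) ≤ max |t - s| L :=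
  nullDist_le (h.z hg ht hs)

lemma nd_lower {β : Type*} [PseudoMetricSpace β] (hg : Adm g) {t s L : ℝ}
    (ht : t ∈ Icc (0:ℝ) 1) (hs : s ∈ Icc (0:ℝ) 1) {x y : S} (h : E g L x y) (ψ : S → β)
    (hψ : ∀ p q : ℝ × S, FutureRelated (fun _ => g) p q → dist (ψ p.2) (ψ q.2) ≤ q.1 - p.1) :
    max |t - s| (dist (ψ x) (ψ y)) ≤
      nullDist (fun _ => g) (fun p => p.1) 0 1 (t, x) (s, y) :=
  le_nullDist (h.z hg ht hs) fun γ => max_le (len_time γ) (len_psi ψ hψ γ)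

/-- along a causal piece on which `g ≥ c`. -/
lemma piece_dist {x : ℝ → S} {a b c : ℝ} (hc : 0 < c)
    (h : FutureCausalPiece (fun _ => g) x a b) {u v : ℝ} (hu : u ∈ Icc a b) (hv : v ∈ Icc a b)
    (huv : u ≤ v) (hgc : ∀ t ∈ Icc u v, c ≤ g (x t)) : c * dist (x u) (x v) ≤ v - u := by
  have h1 := h.2.2 u hu v hv huv
  have h2 := (eVariationOn.edist_le x (s := Icc u v) (left_mem_Icc.2 huv)
    (right_mem_Icc.2 huv)).trans h1
  have hle : |∫ t in u..v, 1 / g (x t)| ≤ 1 / c * |v - u| := by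
    have := intervalIntegral.norm_integral_le_of_norm_le_const (a := u) (b := v) (C := 1 / c)
      (f := fun t => 1 / g (x t)) (fun t ht => by
        rw [uIoc_of_le huv] at ht
        have h1 := hgc t ⟨ht.1.le, ht.2⟩
        rw [Real.norm_eq_abs, abs_of_nonneg (by have := hc.trans_le h1; positivity)]
        exact one_div_le_one_div_of_le hc h1)
    simpa only [Real.norm_eq_abs] using this
  rw [edist_dist] at h2
  have h3 : dist (x u) (x v) ≤ 1 / c * (v - u) := by
    rw [abs_of_nonneg (sub_nonneg.2 huv)] at hle
    have h4 := h2.trans (ENNReal.ofReal_le_ofReal ((le_abs_self _).trans hle))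
    exact (ENNReal.ofReal_le_ofReal_iff
      (mul_nonneg (by positivity) (sub_nonneg.2 huv))).1 h4
  calc c * dist (x u) (x v) ≤ c * (1 / c * (v - u)) := by gcongr
    _ = v - u := by field_simp

end gen
section cross

lemma cross_side {h : ℝ → ℝ} {u v ρ : ℝ} (hc : ContinuousOn h (Icc u v))
    (hn : ∀ t ∈ Ioo u v, h t ≠ ρ) : (∀ t ∈ Icc u v, h t ≤ ρ) ∨ (∀ t ∈ Icc u v, ρ ≤ h t) := by
  by_contra hcon
  push Not at hcon
  obtain ⟨⟨p, hp, hp'⟩, q, hq, hq'⟩ := hcon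
  have hsub : uIcc p q ⊆ Icc u v := by
    rw [← uIcc_of_le (hp.1.trans hp.2)]
    exact uIcc_subset_uIcc (by rw [uIcc_of_le (hp.1.trans hp.2)]; exact hp)
      (by rw [uIcc_of_le (hp.1.trans hp.2)]; exact hq)
  obtain ⟨t, ht, ht'⟩ := intermediate_value_uIcc (hc.mono hsub)
    (show ρ ∈ uIcc (h p) (h q) by rw [mem_uIcc]; right; exact ⟨hq'.le, hp'.le⟩)
  refine hn t ?_ ht'
  have htp : t ≠ p := by rintro rfl; linarith
  have htq : t ≠ q := by rintro rfl; linarith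
  rw [mem_uIcc] at ht
  rcases ht with ht | ht
  · exact ⟨lt_of_le_of_lt hp.1 (lt_of_le_of_ne ht.1 htp.symm),
      lt_of_lt_of_le (lt_of_le_of_ne ht.2 htq) hq.2⟩
  · exact ⟨lt_of_le_of_lt hq.1 (lt_of_le_of_ne ht.1 htq.symm),
      lt_of_lt_of_le (lt_of_le_of_ne ht.2 htp) hp.2⟩

lemma cross {h w : ℝ → ℝ} {a b ρ : ℝ} (hab : a ≤ b) (hc : ContinuousOn h (Icc a b))
    (H1 : ∀ u v, a ≤ u → u ≤ v → v ≤ b → (∀ t ∈ Icc u v, h t ≤ ρ) → |w u - w v| ≤ v - u)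
    (H2 : ∀ u v, a ≤ u → u ≤ v → v ≤ b → (∀ t ∈ Icc u v, ρ ≤ h t) → |w u - w v| ≤ v - u)
    (H3 : ∀ u ∈ Icc a b, ∀ v ∈ Icc a b, h u = ρ → h v = ρ → w u = w v) :
    |w a - w b| ≤ b - a := by
  have side : ∀ u v, a ≤ u → u ≤ v → v ≤ b → (∀ t ∈ Ioo u v, h t ≠ ρ) →
      |w u - w v| ≤ v - u := by
    intro u v h1 h2 h3 hn
    rcases cross_side (hc.mono (Icc_subset_Icc h1 h3)) hn with h | h
    · exact H1 u v h1 h2 h3 h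
    · exact H2 u v h1 h2 h3 h
  by_cases hK : (Icc a b ∩ h ⁻¹' {ρ}).Nonempty
  · have hcomp : IsCompact (Icc a b ∩ h ⁻¹' {ρ}) :=
      isCompact_Icc.of_isClosed_subset
        (hc.preimage_isClosed_of_isClosed isClosed_Icc isClosed_singleton) inter_subset_left
    obtain ⟨p, hp, hp'⟩ := hcomp.exists_isLeast hK
    obtain ⟨q, hq, hq'⟩ := hcomp.exists_isGreatest hK
    have h1 := side a p le_rfl hp.1.1 hp.1.2 (fun t ht ht' => by
      have := hp' ⟨⟨ht.1.le, ht.2.le.trans hp.1.2⟩, ht'⟩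
      linarith [ht.2])
    have h2 := side q b hq.1.1 hq.1.2 le_rfl (fun t ht ht' => by
      have := hq' ⟨⟨hq.1.1.trans ht.1.le, ht.2.le⟩, ht'⟩
      linarith [ht.1])
    have h3 := H3 p hp.1 q hq.1 hp.2 hq.2
    have h4 := hp' hq
    rw [abs_le] at *
    constructor <;> linarith [h1.1, h1.2, h2.1, h2.2]
  · refine side a b le_rfl hab le_rfl fun t ht ht' => hK ⟨t, ⟨ht.1.le, ht.2.le⟩, ht'⟩

end cross

section disk

variable {n : ℕ} {g : Disk n → ℝ}

lemma dist_disk (x y : Disk n) : dist x y = ‖(x : EuclideanSpace ℝ (Fin n)) - y‖ := by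
  rw [Subtype.dist_eq, dist_eq_norm]

lemma norm_disk (x : Disk n) : ‖(x : EuclideanSpace ℝ (Fin n))‖ ≤ 1 := by
  exact mem_closedBall_zero_iff.1 x.2

lemma E_seg (hg : Adm g) {c : ℝ} (hc : 0 < c) (x y : Disk n)
    (h : ∀ z : Disk n, (z : EuclideanSpace ℝ (Fin n)) ∈ segment ℝ (x : EuclideanSpace ℝ (Fin n)) y →
      g z ≤ c) : E g (c * dist x y) x y := by
  by_cases hxy : dist x y = 0
  · have : x = y := by simpa using hxy
    subst this
    exact E.const hg (by positivity) x
  have hd : 0 < dist x y := lt_of_le_of_ne dist_nonneg (Ne.symm hxy)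
  set L := c * dist x y with hL
  have hL0 : 0 < L := by positivity
  let σ : ℝ → ℝ := fun t => max 0 (min 1 (t / L))
  have hσ : ∀ t, σ t ∈ Icc (0:ℝ) 1 := fun t => ⟨le_max_left _ _, max_le zero_le_one (min_le_left _ _)⟩
  have hseg : ∀ t, AffineMap.lineMap (x : EuclideanSpace ℝ (Fin n)) (y : EuclideanSpace ℝ (Fin n)) (σ t) ∈
      segment ℝ (x : EuclideanSpace ℝ (Fin n)) y := by
    intro t
    rw [segment_eq_image_lineMap]
    exact ⟨σ t, hσ t, rfl⟩
  have hmem : ∀ t, AffineMap.lineMap (x : EuclideanSpace ℝ (Fin n)) (y : EuclideanSpace ℝ (Fin n)) (σ t) ∈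
      Metric.closedBall (0 : EuclideanSpace ℝ (Fin n)) 1 := fun t =>
    (convex_closedBall _ _).segment_subset x.2 y.2 (hseg t)
  let γ : ℝ → Disk n := fun t => ⟨_, hmem t⟩
  have hσlip : ∀ c d, c ≤ d → |σ c - σ d| ≤ (d - c) / L := by
    intro c d hcd
    have h1 : c / L ≤ d / L := by gcongr
    have : (d - c) / L = d / L - c / L := by ring
    rw [this]
    simp only [σ]
    rw [abs_le]
    constructor <;> simp only [max_def, min_def] <;> split_ifs <;> linarith
  have hγ : Continuous γ := by
    refine Continuous.subtype_mk ?_ _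
    have : Continuous σ := by fun_prop
    exact AffineMap.lineMap_continuous.comp this
  have hic : Continuous fun t => 1 / g (γ t) :=
    continuous_const.div (hg.1.comp hγ) fun t => by
      have := hg.2 (γ t); exact ne_of_gt (by linarith)
  refine ⟨hL0.le, γ, ?_, ?_, ?_⟩
  · intro a b hab
    have e1 : dist (γ a) (γ b) = |σ a - σ b| * dist x y := by
      rw [Subtype.dist_eq]
      simp only [γ]
      rw [dist_lineMap_lineMap, Real.dist_eq]; rfl
    have e2 : (b - a) * (1 / c) ≤ ∫ t in a..b, 1 / g (γ t) := by
      have : ∫ t in a..b, (1 / c : ℝ) = (b - a) * (1 / c) := by simp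
      rw [← this]
      refine intervalIntegral.integral_mono_on hab (by simp) (hic.intervalIntegrable _ _) ?_
      intro t _
      exact one_div_le_one_div_of_le (by linarith [hg.2 (γ t)]) (h _ (hseg t))
    rw [e1]
    refine le_trans ?_ e2
    calc |σ a - σ b| * dist x y ≤ (b - a) / L * dist x y := by gcongr; exact hσlip a b hab
      _ = (b - a) * (1 / c) := by rw [hL]; field_simp
  · apply Subtype.ext; simp [γ, σ]
  · apply Subtype.ext; simp [γ, σ, div_self hL0.ne']

lemma psi_cross {j ρ : ℝ} (hj : 0 < j) (hg : Adm g)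
    (hin : ∀ x : Disk n, ‖(x : EuclideanSpace ℝ (Fin n))‖ ≤ ρ → j ≤ g x) (ψ : Disk n → ℝ)
    (h1 : ∀ x y : Disk n, ‖(x : EuclideanSpace ℝ (Fin n))‖ ≤ ρ → ‖(y : EuclideanSpace ℝ (Fin n))‖ ≤ ρ →
      |ψ x - ψ y| ≤ j * dist x y)
    (h2 : ∀ x y : Disk n, ρ ≤ ‖(x : EuclideanSpace ℝ (Fin n))‖ → ρ ≤ ‖(y : EuclideanSpace ℝ (Fin n))‖ →
      |ψ x - ψ y| ≤ dist x y)
    (h3 : ∀ x y : Disk n, ‖(x : EuclideanSpace ℝ (Fin n))‖ = ρ → ‖(y : EuclideanSpace ℝ (Fin n))‖ = ρ →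
      ψ x = ψ y)
    (p q : ℝ × Disk n) (h : FutureRelated (fun _ => g) p q) :
    dist (ψ p.2) (ψ q.2) ≤ q.1 - p.1 := by
  obtain ⟨hpq, x, hx, hy, hP⟩ := h
  rw [← hx, ← hy, Real.dist_eq]
  refine cross (h := fun t => ‖(x t : EuclideanSpace ℝ (Fin n))‖) (w := fun t => ψ (x t)) (ρ := ρ)
    hpq ?_ ?_ ?_ ?_
  · exact (continuous_subtype_val.comp_continuousOn hP.2.1).norm
  · intro u v hu huv hv ht
    refine (h1 _ _ (ht u (left_mem_Icc.2 huv)) (ht v (right_mem_Icc.2 huv))).trans ?_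
    exact piece_dist hj hP ⟨hu, huv.trans hv⟩ ⟨hu.trans huv, hv⟩ huv fun t h => hin _ (ht t h)
  · intro u v hu huv hv ht
    refine (h2 _ _ (ht u (left_mem_Icc.2 huv)) (ht v (right_mem_Icc.2 huv))).trans ?_
    have := piece_dist one_pos hP ⟨hu, huv.trans hv⟩ ⟨hu.trans huv, hv⟩ huv fun t h => hg.2 _
    simpa using this
  · intro u _ v _ hu hv
    exact h3 _ _ hu hv

lemma psi_id (hg : Adm g) (p q : ℝ × Disk n) (h : FutureRelated (fun _ => g) p q) :
    dist (id p.2) (id q.2) ≤ q.1 - p.1 := by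
  obtain ⟨hpq, x, hx, hy, hP⟩ := h
  rw [← hx, ← hy]
  have := piece_dist one_pos hP (left_mem_Icc.2 hpq) (right_mem_Icc.2 hpq) hpq fun t h => hg.2 _
  simpa using this

lemma dMink_eq (t s : T01) (x y : Disk n) :
    dMink (t, x) (s, y) = max |(t:ℝ) - s| (dist x y) := by
  have hg : Adm (fun _ : Disk n => (1:ℝ)) := ⟨continuous_const, fun _ => le_rfl⟩
  have hE := E_seg hg one_pos x y (fun _ _ => le_rfl)
  rw [one_mul] at hE
  exact le_antisymm (nd_upper hg t.2 s.2 hE) (nd_lower hg t.2 s.2 hE id (psi_id hg))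

end disk
section bubble

variable {n : ℕ}

lemma exists_dir (hn : 2 ≤ n) (x : EuclideanSpace ℝ (Fin n)) :
    ∃ u : EuclideanSpace ℝ (Fin n), ‖u‖ = 1 ∧ x = ‖x‖ • u := by
  by_cases hx : x = 0
  · have : Nontrivial (EuclideanSpace ℝ (Fin n)) := by
      apply Module.nontrivial_of_finrank_pos (R := ℝ)
      simp; omega
    obtain ⟨u, hu⟩ := exists_norm_eq (EuclideanSpace ℝ (Fin n)) zero_le_one
    exact ⟨u, hu, by simp [hx]⟩
  · have : ‖x‖ ≠ 0 := norm_ne_zero_iff.2 hx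
    refine ⟨‖x‖⁻¹ • x, ?_, ?_⟩
    · rw [norm_smul, norm_inv, norm_norm, inv_mul_cancel₀ this]
    · rw [smul_smul, mul_inv_cancel₀ this, one_smul]

/-- The point of the disk at radius `r` in direction `u`. -/
def ray (u : EuclideanSpace ℝ (Fin n)) (hu : ‖u‖ = 1) (r : ℝ) (h : r ∈ Icc (0:ℝ) 1) : Disk n :=
  ⟨r • u, by
    rw [mem_closedBall_zero_iff, norm_smul, hu, mul_one, Real.norm_eq_abs, abs_of_nonneg h.1]
    exact h.2⟩

lemma norm_ray (u : EuclideanSpace ℝ (Fin n)) (hu : ‖u‖ = 1) (r : ℝ) (h : r ∈ Icc (0:ℝ) 1) :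
    ‖(ray u hu r h : EuclideanSpace ℝ (Fin n))‖ = r := by
  simp only [ray]
  rw [norm_smul, hu, mul_one, Real.norm_eq_abs, abs_of_nonneg h.1]

lemma dist_ray (u : EuclideanSpace ℝ (Fin n)) (hu : ‖u‖ = 1) (r s : ℝ) (h : r ∈ Icc (0:ℝ) 1)
    (h' : s ∈ Icc (0:ℝ) 1) : dist (ray u hu r h) (ray u hu s h') = |r - s| := by
  rw [dist_disk]
  simp only [ray]
  rw [← sub_smul, norm_smul, hu, mul_one, Real.norm_eq_abs]

lemma nm_mem (x : Disk n) : ‖(x : EuclideanSpace ℝ (Fin n))‖ ∈ Icc (0:ℝ) 1 :=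
  ⟨norm_nonneg _, norm_disk x⟩

lemma norm_center : ‖(center n : EuclideanSpace ℝ (Fin n))‖ = 0 := norm_zero

lemma exists_ray (hn : 2 ≤ n) (x : Disk n) :
    ∃ (u : EuclideanSpace ℝ (Fin n)) (hu : ‖u‖ = 1),
      x = ray u hu ‖(x : EuclideanSpace ℝ (Fin n))‖ (nm_mem x) := by
  obtain ⟨u, hu, h⟩ := exists_dir hn (x : EuclideanSpace ℝ (Fin n))
  exact ⟨u, hu, Subtype.ext h⟩

noncomputable def Q (u v : BubbleZ n) : ℝ≥0∞ :=
  (⨅ (k : ℕ) (z : ℕ → BubbleZ n) (_ : z 0 = u) (_ : z (2 * k + 1) = v)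
      (_ : ∀ i < k, bubbleIdent (z (2 * i + 1)) (z (2 * i + 2))),
      ∑ i ∈ Finset.range (k + 1), bubbleBase (z (2 * i)) (z (2 * i + 1)))

lemma Q_le {u v : BubbleZ n} (k : ℕ) (z : ℕ → BubbleZ n) (h0 : z 0 = u) (h1 : z (2 * k + 1) = v)
    (h2 : ∀ i < k, bubbleIdent (z (2 * i + 1)) (z (2 * i + 2))) :
    Q u v ≤ ∑ i ∈ Finset.range (k + 1), bubbleBase (z (2 * i)) (z (2 * i + 1)) :=
  iInf_le_of_le k <| iInf_le_of_le z <| iInf_le_of_le h0 <| iInf_le_of_le h1 <|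
    iInf_le_of_le h2 le_rfl

lemma quot_le {u v : BubbleZ n} {U : ℝ} (hU : 0 ≤ U) (h : Q u v ≤ ENNReal.ofReal U) :
    bubbleQuotDist u v ≤ U := ENNReal.toReal_le_of_le_ofReal hU h

lemma le_Q {β : Type*} [PseudoMetricSpace β] (ψ : BubbleZ n → β)
    (hl : ∀ a b, dist (ψ (Sum.inl a)) (ψ (Sum.inl b)) ≤ dMink a b)
    (hr : ∀ a b, dist (ψ (Sum.inr a)) (ψ (Sum.inr b)) ≤ dMink a b)
    (hi : ∀ (t : T01) (x : Disk n), ‖(x : EuclideanSpace ℝ (Fin n))‖ = 1 →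
      ψ (Sum.inl (t, x)) = ψ (Sum.inr (t, center n))) (u v : BubbleZ n) :
    edist (ψ u) (ψ v) ≤ Q u v := by
  have hb : ∀ z w, edist (ψ z) (ψ w) ≤ bubbleBase z w := by
    rintro (a | a) (b | b)
    · rw [edist_dist]; exact ENNReal.ofReal_le_ofReal (hl a b)
    · exact le_top
    · exact le_top
    · rw [edist_dist]; exact ENNReal.ofReal_le_ofReal (hr a b)
  have hid : ∀ z w, bubbleIdent z w → ψ z = ψ w := by
    rintro z w (rfl | ⟨t, x, hx, rfl, rfl⟩ | ⟨t, x, hx, rfl, rfl⟩)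
    · rfl
    · exact hi t x hx
    · exact (hi t x hx).symm
  refine le_iInf fun k => le_iInf fun z => le_iInf fun h0 => le_iInf fun h1 => le_iInf fun h2 => ?_
  subst h0 h1
  induction k with
  | zero => simpa using hb _ _
  | succ k ih =>
    rw [Finset.sum_range_succ]
    have h3 := ih fun i hi => h2 i (by omega)
    refine (edist_triangle _ (ψ (z (2 * k + 1))) _).trans (add_le_add h3 ?_)
    rw [hid _ _ (h2 k (by omega))]
    exact hb _ _

lemma le_quot {β : Type*} [PseudoMetricSpace β] (ψ : BubbleZ n → β)
    (hl : ∀ a b, dist (ψ (Sum.inl a)) (ψ (Sum.inl b)) ≤ dMink a b)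
    (hr : ∀ a b, dist (ψ (Sum.inr a)) (ψ (Sum.inr b)) ≤ dMink a b)
    (hi : ∀ (t : T01) (x : Disk n), ‖(x : EuclideanSpace ℝ (Fin n))‖ = 1 →
      ψ (Sum.inl (t, x)) = ψ (Sum.inr (t, center n))) {u v : BubbleZ n} {U : ℝ}
    (hU : Q u v ≤ ENNReal.ofReal U) :
    dist (ψ u) (ψ v) ≤ bubbleQuotDist u v := by
  have h := le_Q ψ hl hr hi u v
  rw [edist_dist] at h
  exact (ENNReal.ofReal_le_iff_le_toReal (ne_top_of_le_ne_top ENNReal.ofReal_ne_top hU)).1 h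

def tm : BubbleZ n → ℝ := Sum.elim (fun a => (a.1 : ℝ)) (fun a => (a.1 : ℝ))

lemma quot_eq {β : Type*} [PseudoMetricSpace β] (θ₁ θ₂ : Disk n → β)
    (h1 : ∀ x y, dist (θ₁ x) (θ₁ y) ≤ dist x y) (h2 : ∀ x y, dist (θ₂ x) (θ₂ y) ≤ dist x y)
    (h3 : ∀ x : Disk n, ‖(x : EuclideanSpace ℝ (Fin n))‖ = 1 → θ₁ x = θ₂ (center n))
    {u v : BubbleZ n} {D : ℝ}
    (hD : D ≤ dist (Sum.elim (fun a : T01 × Disk n => θ₁ a.2) (fun a : T01 × Disk n => θ₂ a.2) u)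
      (Sum.elim (fun a : T01 × Disk n => θ₁ a.2) (fun a : T01 × Disk n => θ₂ a.2) v))
    (hU : Q u v ≤ ENNReal.ofReal (max |tm u - tm v| D)) :
    bubbleQuotDist u v = max |tm u - tm v| D := by
  refine le_antisymm (quot_le (le_max_of_le_left (abs_nonneg _)) hU) (max_le ?_ (hD.trans ?_))
  · refine le_quot tm ?_ ?_ ?_ hU
    · rintro ⟨t, x⟩ ⟨s, y⟩; rw [dMink_eq]; exact le_max_left _ _
    · rintro ⟨t, x⟩ ⟨s, y⟩; rw [dMink_eq]; exact le_max_left _ _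
    · intro t x _; rfl
  · refine le_quot (Sum.elim (fun a : T01 × Disk n => θ₁ a.2) (fun a => θ₂ a.2)) ?_ ?_ ?_ hU
    · rintro ⟨t, x⟩ ⟨s, y⟩; rw [dMink_eq]; exact (h1 x y).trans (le_max_right _ _)
    · rintro ⟨t, x⟩ ⟨s, y⟩; rw [dMink_eq]; exact (h2 x y).trans (le_max_right _ _)
    · intro t x hx; exact h3 x hx

lemma exists_mid (t s : T01) {A B : ℝ} (hA : 0 ≤ A) (hB : 0 ≤ B) : ∃ m : T01,
    max |(t:ℝ) - m| A + max |(m:ℝ) - s| B = max |(t:ℝ) - s| (A + B) := by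
  obtain ⟨t, ht⟩ := t
  obtain ⟨s, hs⟩ := s
  rcases le_total t s with h | h
  · rcases le_total s (t + A) with h' | h'
    · refine ⟨⟨s, hs⟩, ?_⟩
      simp only [sub_self, abs_zero, max_eq_right hB]
      rw [abs_sub_comm, abs_of_nonneg (by linarith), max_eq_right, max_eq_right] <;> linarith
    · refine ⟨⟨t + A, by linarith [ht.1], by linarith [hs.2]⟩, ?_⟩
      simp only
      rw [abs_sub_comm t s, abs_sub_comm t (t + A), abs_sub_comm (t + A) s,
        abs_of_nonneg, abs_of_nonneg, abs_of_nonneg, max_eq_right (by linarith), ← max_add_add_left] <;>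
        try linarith
      congr 1; ring
  · rcases le_total (t - A) s with h' | h'
    · refine ⟨⟨s, hs⟩, ?_⟩
      simp only [sub_self, abs_zero, max_eq_right hB]
      rw [abs_of_nonneg (by linarith), max_eq_right, max_eq_right] <;> linarith
    · refine ⟨⟨t - A, by linarith [hs.1], by linarith [ht.2]⟩, ?_⟩
      simp only
      rw [abs_of_nonneg, abs_of_nonneg, abs_of_nonneg, max_eq_right (by linarith), ← max_add_add_left] <;>
        try linarith
      congr 1; ring

lemma norm_lip (x y : Disk n) :
    |‖(x : EuclideanSpace ℝ (Fin n))‖ - ‖(y : EuclideanSpace ℝ (Fin n))‖| ≤ dist x y := by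
  rw [dist_disk]; exact abs_norm_sub_norm_le _ _

lemma base_l (t s : T01) (x y : Disk n) : bubbleBase (Sum.inl (t, x)) (Sum.inl (s, y))
    = ENNReal.ofReal (max |(t:ℝ) - s| (dist x y)) := by
  rw [← dMink_eq]; rfl

lemma base_r (t s : T01) (x y : Disk n) : bubbleBase (Sum.inr (t, x)) (Sum.inr (s, y))
    = ENNReal.ofReal (max |(t:ℝ) - s| (dist x y)) := by
  rw [← dMink_eq]; rfl

lemma dist_center (y : Disk n) : dist (center n) y = ‖(y : EuclideanSpace ℝ (Fin n))‖ := by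
  rw [dist_disk]; simp [center]

lemma Q_rr (t s : T01) (x y : Disk n) : bubbleQuotDist (Sum.inr (t, x)) (Sum.inr (s, y))
    = max |(t:ℝ) - s| (dist x y) := by
  refine quot_eq (fun _ => center n) id (fun x y => by simp) (fun x y => le_rfl)
    (fun x _ => rfl) le_rfl ?_
  refine (Q_le 0 (fun i => if i = 0 then Sum.inr (t, x) else Sum.inr (s, y)) (by simp) (by simp)
    (by simp)).trans ?_
  simp [base_r, tm]

lemma exists_bd (hn : 2 ≤ n) (x : Disk n) : ∃ b : Disk n, ‖(b : EuclideanSpace ℝ (Fin n))‖ = 1 ∧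
    dist x b = 1 - ‖(x : EuclideanSpace ℝ (Fin n))‖ := by
  obtain ⟨u, hu, h⟩ := exists_ray hn x
  refine ⟨ray u hu 1 (by simp), norm_ray _ _ _ _, ?_⟩
  have e := dist_ray u hu _ 1 (nm_mem x) (by simp)
  rw [← h] at e
  rw [e, abs_sub_comm, abs_of_nonneg]
  linarith [norm_disk x]

lemma nn_max (a b c : ℝ) : 0 ≤ max |a - b| c := le_max_of_le_left (abs_nonneg _)

lemma Q_lr (hn : 2 ≤ n) (t s : T01) (x y : Disk n) :
    bubbleQuotDist (Sum.inl (t, x)) (Sum.inr (s, y))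
    = max |(t:ℝ) - s| (1 - ‖(x : EuclideanSpace ℝ (Fin n))‖ + ‖(y : EuclideanSpace ℝ (Fin n))‖) := by
  refine quot_eq (fun x => ‖(x : EuclideanSpace ℝ (Fin n))‖)
    (fun x => 1 + ‖(x : EuclideanSpace ℝ (Fin n))‖)
    (fun x y => by rw [Real.dist_eq]; exact norm_lip x y)
    (fun x y => by rw [Real.dist_eq, add_sub_add_left_eq_sub]; exact norm_lip x y)
    (fun x hx => by rw [hx, norm_center, add_zero]) ?_ ?_
  · simp only [Sum.elim_inl, Sum.elim_inr]
    rw [dist_comm, Real.dist_eq]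
    refine le_trans (le_of_eq ?_) (le_abs_self _)
    ring
  obtain ⟨b, hb, hxb⟩ := exists_bd hn x
  obtain ⟨m, hm⟩ := exists_mid t s (sub_nonneg.2 (norm_disk x)) (norm_nonneg (y : EuclideanSpace ℝ (Fin n)))
  refine (Q_le 1 (fun i => if i = 0 then Sum.inl (t, x) else if i = 1 then Sum.inl (m, b) else
    if i = 2 then Sum.inr (m, center n) else Sum.inr (s, y)) (by simp) (by simp) ?_).trans ?_
  · intro i hi
    have : i = 0 := by omega
    subst this
    right; left
    exact ⟨m, b, hb, by simp, by simp⟩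
  · simp only [Finset.sum_range_succ, Finset.sum_range_zero]
    simp only [tm, Sum.elim_inl, Sum.elim_inr]
    rw [← hm, ENNReal.ofReal_add (nn_max _ _ _) (nn_max _ _ _)]
    simp [base_l, base_r, hxb, dist_center]

lemma Q_rl (hn : 2 ≤ n) (t s : T01) (x y : Disk n) :
    bubbleQuotDist (Sum.inr (t, x)) (Sum.inl (s, y))
    = max |(t:ℝ) - s| (1 - ‖(y : EuclideanSpace ℝ (Fin n))‖ + ‖(x : EuclideanSpace ℝ (Fin n))‖) := by
  refine quot_eq (fun x => ‖(x : EuclideanSpace ℝ (Fin n))‖)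
    (fun x => 1 + ‖(x : EuclideanSpace ℝ (Fin n))‖)
    (fun x y => by rw [Real.dist_eq]; exact norm_lip x y)
    (fun x y => by rw [Real.dist_eq, add_sub_add_left_eq_sub]; exact norm_lip x y)
    (fun x hx => by rw [hx, norm_center, add_zero]) ?_ ?_
  · simp only [Sum.elim_inl, Sum.elim_inr]
    rw [Real.dist_eq]
    refine le_trans (le_of_eq ?_) (le_abs_self _)
    ring
  obtain ⟨b, hb, hxb⟩ := exists_bd hn y
  obtain ⟨m, hm⟩ := exists_mid t s (norm_nonneg (x : EuclideanSpace ℝ (Fin n))) (sub_nonneg.2 (norm_disk y))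
  refine (Q_le 1 (fun i => if i = 0 then Sum.inr (t, x) else if i = 1 then Sum.inr (m, center n) else
    if i = 2 then Sum.inl (m, b) else Sum.inl (s, y)) (by simp) (by simp) ?_).trans ?_
  · intro i hi
    have : i = 0 := by omega
    subst this
    right; right
    exact ⟨m, b, hb, by simp, by simp⟩
  · simp only [Finset.sum_range_succ, Finset.sum_range_zero]
    simp only [tm, Sum.elim_inl, Sum.elim_inr]
    rw [add_comm (1 - _), ← hm, ENNReal.ofReal_add (nn_max _ _ _) (nn_max _ _ _)]
    simp [base_l, base_r, dist_comm b y, hxb, dist_comm x (center n), dist_center]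

lemma min_lip {a b c d e : ℝ} (h1 : |a - b| ≤ e) (h2 : |c - d| ≤ e) : |min a c - min b d| ≤ e :=
  (abs_min_sub_min_le_max a c b d).trans (max_le h1 h2)

lemma Q_ll (hn : 2 ≤ n) (t s : T01) (x y : Disk n) :
    bubbleQuotDist (Sum.inl (t, x)) (Sum.inl (s, y))
    = max |(t:ℝ) - s| (min (dist x y)
      (1 - ‖(x : EuclideanSpace ℝ (Fin n))‖ + (1 - ‖(y : EuclideanSpace ℝ (Fin n))‖))) := by
  have hx1 := norm_disk x
  have hy1 := norm_disk y
  refine quot_eq (fun z => min (dist x z)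
      (1 - ‖(x : EuclideanSpace ℝ (Fin n))‖ + (1 - ‖(z : EuclideanSpace ℝ (Fin n))‖)))
    (fun _ => 1 - ‖(x : EuclideanSpace ℝ (Fin n))‖) ?_
    (fun x y => by simp)
    ?_ ?_ ?_
  · intro z w
    rw [Real.dist_eq]
    refine min_lip ?_ ?_
    · rw [dist_comm x z, dist_comm x w]; exact abs_dist_sub_le z w x
    · rw [abs_sub_comm]
      refine le_trans (le_of_eq ?_) (norm_lip z w)
      congr 1; ring
  · intro z hz
    simp only [hz, sub_self, add_zero]
    apply min_eq_right
    have := norm_lip x z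
    rw [hz] at this
    linarith [neg_abs_le (‖(x : EuclideanSpace ℝ (Fin n))‖ - 1)]
  · simp only [Sum.elim_inl]
    rw [dist_self, min_eq_left (a := (0:ℝ)) (by linarith), Real.dist_eq, zero_sub, abs_neg]
    exact le_abs_self _
  · obtain ⟨b, hb, hxb⟩ := exists_bd hn x
    obtain ⟨c, hc, hyc⟩ := exists_bd hn y
    simp only [tm, Sum.elim_inl]
    rw [max_min_distrib_left, ENNReal.ofReal_min]
    refine le_min ?_ ?_
    · refine (Q_le 0 (fun i => if i = 0 then Sum.inl (t, x) else Sum.inl (s, y)) (by simp) (by simp)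
        (by simp)).trans ?_
      simp [base_l]
    · obtain ⟨m, hm⟩ := exists_mid t s (sub_nonneg.2 hx1) (sub_nonneg.2 hy1)
      refine (Q_le 2 (fun i => if i = 0 then Sum.inl (t, x) else if i = 1 then Sum.inl (m, b) else
        if i = 2 then Sum.inr (m, center n) else if i = 3 then Sum.inr (m, center n) else
        if i = 4 then Sum.inl (m, c) else Sum.inl (s, y)) (by simp) (by simp) ?_).trans ?_
      · intro i hi
        have : i = 0 ∨ i = 1 := by omega
        rcases this with rfl | rfl
        · right; left
          exact ⟨m, b, hb, by simp, by simp⟩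
        · right; right
          exact ⟨m, c, hc, by simp, by simp⟩
      · simp only [Finset.sum_range_succ, Finset.sum_range_zero]
        rw [← hm, ENNReal.ofReal_add (nn_max _ _ _) (nn_max _ _ _)]
        simp [base_l, base_r, hxb, dist_comm c y, hyc]

end bubble
section prof

structure Prof (j : ℕ) (C : ℝ) (f : ℝ → ℝ) : Prop where
  hj : 3 ≤ j
  hC : 0 < C
  c : ContinuousOn f (Icc 0 1)
  a : ∀ r ∈ Icc (0:ℝ) (1 / (j:ℝ)), f r = (j : ℝ)
  m : AntitoneOn f (Icc (1 / (j:ℝ)) (3 / (2 * (j:ℝ))))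
  b : ∀ r ∈ Icc (3 / (2 * (j:ℝ))) 1, f r = 1
  one : ∀ r ∈ Icc (0:ℝ) 1, 1 ≤ f r
  int : (∫ r in (1 / (j:ℝ))..(3 / (2 * (j:ℝ))), f r) ≤ C / (j:ℝ)

noncomputable def gg (n : ℕ) (f : ℝ → ℝ) : Disk n → ℝ := fun x => f ‖(x : EuclideanSpace ℝ (Fin n))‖

variable {n j : ℕ} {C : ℝ} {f : ℝ → ℝ}

lemma Prof.adm (P : Prof j C f) : Adm (gg n f) :=
  ⟨P.c.comp_continuous (continuous_subtype_val.norm) fun x => nm_mem x,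
    fun x => P.one _ (nm_mem x)⟩

lemma Prof.jr (P : Prof j C f) : (3:ℝ) ≤ j := by exact_mod_cast P.hj

lemma Prof.jpos (P : Prof j C f) : (0:ℝ) < j := by linarith [P.jr]

/-- arithmetic of radii: with `e = 1/j`. -/
lemma Prof.e (P : Prof j C f) : ∃ e : ℝ, 0 < e ∧ 3 * e ≤ 1 ∧ 1 / (j:ℝ) = e ∧
    3 / (2 * (j:ℝ)) = 3 / 2 * e ∧ (j:ℝ) * e = 1 := by
  have h := P.jr
  have h0 := P.jpos
  refine ⟨1 / j, by positivity, ?_, rfl, ?_, ?_⟩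
  · rw [mul_one_div, div_le_one h0]; exact h
  · field_simp
  · field_simp

lemma Prof.le_j (P : Prof j C f) {r : ℝ} (hr : r ∈ Icc (0:ℝ) 1) : f r ≤ j := by
  obtain ⟨e, he, he3, e1, e2, e3⟩ := P.e
  rcases le_total r (1 / (j:ℝ)) with h | h
  · exact (P.a r ⟨hr.1, h⟩).le
  rcases le_total r (3 / (2 * (j:ℝ))) with h' | h'
  · rw [← P.a (1 / (j:ℝ)) ⟨by rw [e1]; exact he.le, le_rfl⟩]
    exact P.m ⟨le_rfl, h.trans h'⟩ ⟨h, h'⟩ h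
  · rw [P.b r ⟨h', hr.2⟩]; linarith [P.jr]

lemma Prof.seg (P : Prof j C f) (x y : Disk n) : E (gg n f) (j * dist x y) x y :=
  E_seg P.adm P.jpos x y fun z _ => P.le_j (nm_mem z)

lemma Prof.segOut (P : Prof j C f) (x y : Disk n)
    (h : ∀ z ∈ segment ℝ (x : EuclideanSpace ℝ (Fin n)) y, 3 / (2 * (j:ℝ)) ≤ ‖z‖) :
    E (gg n f) (dist x y) x y := by
  have := E_seg (P.adm (n := n)) one_pos x y fun z hz => (P.b _ ⟨h z hz, norm_disk z⟩).le
  rwa [one_mul] at this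

lemma seg_ray (u : EuclideanSpace ℝ (Fin n)) (hu : ‖u‖ = 1) {r s : ℝ} (h : r ∈ Icc (0:ℝ) 1)
    (h' : s ∈ Icc (0:ℝ) 1) (hrs : r ≤ s) {z : EuclideanSpace ℝ (Fin n)}
    (hz : z ∈ segment ℝ (ray u hu r h : EuclideanSpace ℝ (Fin n)) (ray u hu s h')) :
    ‖z‖ ∈ Icc r s := by
  obtain ⟨a, b, ha, hb, hab, rfl⟩ := hz
  simp only [ray]
  have hr0 := h.1
  have hs0 := h'.1
  rw [smul_smul, smul_smul, ← add_smul, norm_smul, hu, mul_one, Real.norm_eq_abs,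
    abs_of_nonneg (by positivity)]
  have : a = 1 - b := by linarith
  subst this
  constructor <;> nlinarith

lemma Prof.ann (P : Prof j C f) (u : EuclideanSpace ℝ (Fin n)) (hu : ‖u‖ = 1) {r s : ℝ}
    (h : r ∈ Icc (0:ℝ) 1) (h' : s ∈ Icc (0:ℝ) 1) (hrs : r ≤ s) (hr : 1 / (j:ℝ) ≤ r)
    (hs : s ≤ 3 / (2 * (j:ℝ))) : E (gg n f) (f r * (s - r)) (ray u hu r h) (ray u hu s h') := by
  have h1 := P.one r h
  have := E_seg (P.adm (n := n)) (c := f r) (by linarith) (ray u hu r h) (ray u hu s h') fun z hz => by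
    have := seg_ray u hu h h' hrs hz
    exact P.m ⟨hr, hrs.trans hs⟩ ⟨hr.trans this.1, this.2.trans hs⟩ this.1
  rwa [dist_ray, abs_sub_comm, abs_of_nonneg (by linarith)] at this

lemma Prof.outRay (P : Prof j C f) (u : EuclideanSpace ℝ (Fin n)) (hu : ‖u‖ = 1) {r s : ℝ}
    (h : r ∈ Icc (0:ℝ) 1) (h' : s ∈ Icc (0:ℝ) 1) (hrs : r ≤ s) (hr : 3 / (2 * (j:ℝ)) ≤ r) :
    E (gg n f) (s - r) (ray u hu r h) (ray u hu s h') := by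
  have := P.segOut (ray u hu r h) (ray u hu s h') fun z hz => hr.trans (seg_ray u hu h h' hrs hz).1
  rwa [dist_ray, abs_sub_comm, abs_of_nonneg (by linarith)] at this

lemma Prof.annInt (P : Prof j C f) (u : EuclideanSpace ℝ (Fin n)) (hu : ‖u‖ = 1) {r s : ℝ}
    (h : r ∈ Icc (0:ℝ) 1) (h' : s ∈ Icc (0:ℝ) 1) (hr : 1 / (j:ℝ) ≤ r) (hrs : r ≤ s)
    (hs : s = 3 / (2 * (j:ℝ))) :
    E (gg n f) ((C + 1) / j) (ray u hu r h) (ray u hu s h') := by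
  obtain ⟨e, he, he3, e1, e2, e3⟩ := P.e
  have hj := P.jpos
  set Δ := (s - r) / j with hΔ
  have hΔ0 : 0 ≤ Δ := div_nonneg (by linarith) hj.le
  have hjΔ : j * Δ = s - r := by rw [hΔ]; field_simp
  have hsub : Icc r s ⊆ Icc (1 / (j:ℝ)) (3 / (2 * (j:ℝ))) := Icc_subset_Icc hr hs.le
  have hsub1 : Icc (1 / (j:ℝ)) (3 / (2 * (j:ℝ))) ⊆ Icc (0:ℝ) 1 :=
    Icc_subset_Icc (by rw [e1]; exact he.le) (by rw [e2]; linarith)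
  have hii : ∀ a ∈ Icc (1 / (j:ℝ)) (3 / (2 * (j:ℝ))), ∀ b ∈ Icc (1 / (j:ℝ)) (3 / (2 * (j:ℝ))),
      IntervalIntegrable f MeasureTheory.volume a b := by
    intro a ha b hb
    refine (P.c.mono ?_).intervalIntegrable
    exact (ordConnected_Icc.uIcc_subset ha hb).trans hsub1
  have hmem : ∀ i : ℕ, i ≤ j → r + i * Δ ∈ Icc r s := by
    intro i hi
    have : (i:ℝ) ≤ j := by exact_mod_cast hi
    have h0 : (0:ℝ) ≤ i := Nat.cast_nonneg i
    constructor
    · nlinarith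
    · nlinarith
  have claim : ∀ i : ℕ, i + 1 ≤ j → ∀ (t : ℝ) (ht : t ∈ Icc (0:ℝ) 1), t = r + (i + 1) * Δ →
      E (gg n f) (f r * Δ + ∫ x in r..(r + i * Δ), f x) (ray u hu r h) (ray u hu t ht) := by
    intro i
    induction i with
    | zero =>
      intro hi t ht htt
      have hm := hmem 1 hi
      have := P.ann u hu h ht (by rw [htt]; simp [hΔ0]) hr
        (by rw [htt, ← hs]; simpa using hm.2)
      simpa [htt] using this
    | succ i ih =>
      intro hi t ht htt
      push_cast at htt
      have hm1 := hmem (i + 1) (by omega)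
      have hm2 := hmem (i + 2) (by omega)
      have hm0 := hmem i (by omega)
      push_cast at hm1 hm2
      have hq : r + (i + 1) * Δ ∈ Icc (0:ℝ) 1 := hsub1 (hsub hm1)
      have k1 := ih (by omega) _ hq rfl
      have k2 := P.ann u hu hq ht (by rw [htt]; nlinarith) (hsub hm1).1 (by
        rw [htt]; have := (hsub hm2).2; linarith)
      refine (k1.trans P.adm k2).mono P.adm ?_
      push_cast
      rw [add_assoc]
      gcongr
      rw [← intervalIntegral.integral_add_adjacent_intervals
        (hii r (hsub ⟨le_rfl, hrs⟩) (r + i * Δ) (hsub hm0))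
        (hii (r + i * Δ) (hsub hm0) (r + (i + 1) * Δ) (hsub hm1))]
      gcongr
      have hle : r + i * Δ ≤ r + (i + 1) * Δ := by linarith
      have : ∫ x in (r + i * Δ)..(r + (i + 1) * Δ), f (r + (i + 1) * Δ)
          = f (r + (i + 1) * Δ) * (t - (r + (i + 1) * Δ)) := by
        rw [intervalIntegral.integral_const, smul_eq_mul, htt]; ring
      rw [← this]
      refine intervalIntegral.integral_mono_on hle (by simp) (hii _ (hsub hm0) _ (hsub hm1)) ?_
      intro x hx
      exact P.m (hsub ⟨hm0.1.trans hx.1, hx.2.trans hm1.2⟩) (hsub hm1) hx.2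
  obtain ⟨k, hk⟩ : ∃ k, j = k + 1 := ⟨j - 1, by have := P.hj; omega⟩
  have hkj : (j:ℝ) = k + 1 := by rw [hk]; push_cast; ring
  refine (claim k (by omega) s h' (by rw [← hkj, hjΔ]; ring)).mono P.adm ?_
  have hmk := hmem k (by omega)
  have i1 : ∫ x in r..(r + k * Δ), f x ≤ ∫ x in (1 / (j:ℝ))..(3 / (2 * (j:ℝ))), f x := by
    refine intervalIntegral.integral_mono_interval hr hmk.1 (hsub hmk).2 ?_
      (hii _ ⟨le_rfl, by rw [e1, e2]; linarith⟩ _ ⟨by rw [e1, e2]; linarith, le_rfl⟩)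
    refine (MeasureTheory.ae_restrict_iff' measurableSet_Ioc).2 (Filter.Eventually.of_forall ?_)
    intro x hx
    have := P.one x (hsub1 ⟨hx.1.le, hx.2⟩)
    simp only [Pi.zero_apply]; linarith
  have i2 : f r * Δ ≤ 1 / j := by
    have := P.le_j h
    calc f r * Δ ≤ j * Δ := by gcongr
      _ = s - r := hjΔ
      _ ≤ 1 / j := by rw [hs, e2]; rw [e1] at hr ⊢; linarith
  have : (C + 1) / (j:ℝ) = C / j + 1 / j := by ring
  rw [this]
  linarith [P.int]

lemma norm_comb {u v : EuclideanSpace ℝ (Fin n)} (hu : ‖u‖ = 1) (hv : ‖v‖ = 1)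
    (huv : 0 ≤ inner ℝ u v) {a b : ℝ} (ha : 0 ≤ a) (hb : 0 ≤ b) (hab : a + b = 1) :
    1 / 2 ≤ ‖a • u + b • v‖ := by
  have h := norm_add_sq_real (a • u) (b • v)
  rw [norm_smul, norm_smul, hu, hv, real_inner_smul_left, real_inner_smul_right, mul_one, mul_one,
    Real.norm_eq_abs, Real.norm_eq_abs, sq_abs, sq_abs] at h
  have h1 : 0 ≤ a * (b * inner ℝ u v) := by positivity
  have h2 : b = 1 - a := by linarith
  have h3 : (1/2:ℝ) ^ 2 ≤ ‖a • u + b • v‖ ^ 2 := by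
    rw [h]
    subst h2
    nlinarith [sq_nonneg (a - 1/2)]
  exact (pow_le_pow_iff_left₀ (by norm_num) (norm_nonneg _) two_ne_zero).1 h3

lemma Prof.around1 (P : Prof j C f) {u v : EuclideanSpace ℝ (Fin n)} (hu : ‖u‖ = 1)
    (hv : ‖v‖ = 1) (huv : 0 ≤ inner ℝ u v) {r : ℝ} (h : r ∈ Icc (0:ℝ) 1)
    (hr : r = 3 / (2 * (j:ℝ))) :
    E (gg n f) (9 / j) (ray u hu r h) (ray v hv r h) := by
  obtain ⟨e, he, he3, e1, e2, e3⟩ := P.e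
  have h2 : 2 * r ∈ Icc (0:ℝ) 1 := by rw [hr, e2]; constructor <;> linarith
  have k1 := P.outRay u hu h h2 (by linarith [h.1]) hr.ge
  have k3 := (P.outRay v hv h h2 (by linarith [h.1]) hr.ge).symm
  have k2 : E (gg n f) (dist (ray u hu (2 * r) h2) (ray v hv (2 * r) h2)) _ _ := P.segOut _ _ (by
    rintro z ⟨a, b, ha, hb, hab, rfl⟩
    have := norm_comb hu hv huv ha hb hab
    simp only [ray]
    rw [smul_comm a, smul_comm b, ← smul_add, norm_smul, Real.norm_eq_abs, abs_of_nonneg h2.1, ← hr]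
    nlinarith [h.1])
  refine ((k1.trans P.adm k2).trans P.adm k3).mono P.adm ?_
  have hd : dist (ray u hu (2 * r) h2) (ray v hv (2 * r) h2) ≤ 4 * r := by
    refine (dist_triangle _ (center n) _).trans ?_
    rw [dist_comm, dist_center, dist_center, norm_ray, norm_ray]; linarith
  have : 9 / (j:ℝ) = 9 * e := by rw [← e1]; ring
  rw [this]
  rw [e2] at hr
  linarith

lemma exists_orth (hn : 2 ≤ n) (u v : EuclideanSpace ℝ (Fin n)) :
    ∃ w : EuclideanSpace ℝ (Fin n), ‖w‖ = 1 ∧ inner ℝ u w = 0 ∧ 0 ≤ inner ℝ w v := by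
  have hne : (Submodule.span ℝ {u})ᗮ ≠ ⊥ := by
    intro hbot
    rw [Submodule.orthogonal_eq_bot_iff] at hbot
    have h1 := finrank_span_le_card (R := ℝ) ({u} : Set (EuclideanSpace ℝ (Fin n)))
    rw [hbot, finrank_top] at h1
    simp at h1
    omega
  obtain ⟨w, hw, hw0⟩ := Submodule.exists_mem_ne_zero_of_ne_bot hne
  have hort : inner ℝ u w = 0 := Submodule.mem_orthogonal_singleton_iff_inner_right.1 hw
  have hnw : ‖w‖ ≠ 0 := norm_ne_zero_iff.2 hw0
  have hn1 : ‖‖w‖⁻¹ • w‖ = 1 := by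
    rw [norm_smul, norm_inv, norm_norm, inv_mul_cancel₀ hnw]
  have ho1 : inner ℝ u (‖w‖⁻¹ • w) = 0 := by rw [real_inner_smul_right, hort, mul_zero]
  rcases le_total 0 (inner ℝ (‖w‖⁻¹ • w) v) with h | h
  · exact ⟨_, hn1, ho1, h⟩
  · refine ⟨-(‖w‖⁻¹ • w), by rw [norm_neg, hn1], by rw [inner_neg_right, ho1, neg_zero], ?_⟩
    rw [inner_neg_left]; linarith

lemma Prof.around (P : Prof j C f) (hn : 2 ≤ n) {u v : EuclideanSpace ℝ (Fin n)} (hu : ‖u‖ = 1)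
    (hv : ‖v‖ = 1) {r : ℝ} (h : r ∈ Icc (0:ℝ) 1) (hr : r = 3 / (2 * (j:ℝ))) :
    E (gg n f) (18 / j) (ray u hu r h) (ray v hv r h) := by
  obtain ⟨w, hw, h1, h2⟩ := exists_orth hn u v
  refine ((P.around1 hu hw h1.ge h hr).trans P.adm (P.around1 hw hv h2 h hr)).mono P.adm ?_
  apply le_of_eq; ring

lemma Prof.mem_r (P : Prof j C f) : 3 / (2 * (j:ℝ)) ∈ Icc (0:ℝ) 1 := by
  obtain ⟨e, he, he3, e1, e2, e3⟩ := P.e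
  rw [e2]; constructor <;> linarith

lemma Prof.toRay (P : Prof j C f) (hn : 2 ≤ n) (y : Disk n)
    (hy : 1 / (j:ℝ) ≤ ‖(y : EuclideanSpace ℝ (Fin n))‖) :
    ∃ (u : EuclideanSpace ℝ (Fin n)) (hu : ‖u‖ = 1),
      E (gg n f) (‖(y : EuclideanSpace ℝ (Fin n))‖ + (C + 1) / j) y (ray u hu _ P.mem_r) := by
  obtain ⟨e, he, he3, e1, e2, e3⟩ := P.e
  have hj := P.jpos
  have hC := P.hC
  have hp : 0 ≤ (C + 1) / (j:ℝ) := by positivity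
  obtain ⟨u, hu, h⟩ := exists_ray hn y
  refine ⟨u, hu, ?_⟩
  rcases le_total ‖(y : EuclideanSpace ℝ (Fin n))‖ (3 / (2 * (j:ℝ))) with h' | h'
  · have := P.annInt u hu (nm_mem y) P.mem_r hy h' rfl
    rw [← h] at this
    exact this.mono P.adm (by linarith [norm_nonneg (y : EuclideanSpace ℝ (Fin n))])
  · have := (P.outRay u hu P.mem_r (nm_mem y) h' le_rfl).symm
    rw [← h] at this
    exact this.mono P.adm (by rw [e2]; linarith)

lemma Prof.far (P : Prof j C f) (hn : 2 ≤ n) (x y : Disk n)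
    (hx : 1 / (j:ℝ) ≤ ‖(x : EuclideanSpace ℝ (Fin n))‖)
    (hy : 1 / (j:ℝ) ≤ ‖(y : EuclideanSpace ℝ (Fin n))‖) :
    E (gg n f) (‖(x : EuclideanSpace ℝ (Fin n))‖ + ‖(y : EuclideanSpace ℝ (Fin n))‖ + (2 * C + 20) / j)
      x y := by
  obtain ⟨u, hu, h1⟩ := P.toRay hn x hx
  obtain ⟨v, hv, h2⟩ := P.toRay hn y hy
  refine ((h1.trans P.adm (P.around hn hu hv P.mem_r rfl)).trans P.adm h2.symm).mono P.adm ?_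
  apply le_of_eq; ring

lemma Prof.U_rr (P : Prof j C f) (hn : 2 ≤ n) (x y : Disk n)
    (hx : 1 / (j:ℝ) ≤ ‖(x : EuclideanSpace ℝ (Fin n))‖)
    (hy : 1 / (j:ℝ) ≤ ‖(y : EuclideanSpace ℝ (Fin n))‖) :
    E (gg n f) (dist x y + (2 * C + 23) / j) x y := by
  have hj := P.jpos
  have hC := P.hC
  by_cases h : ∀ z ∈ segment ℝ (x : EuclideanSpace ℝ (Fin n)) y, 3 / (2 * (j:ℝ)) ≤ ‖z‖
  · exact (P.segOut x y h).mono P.adm (le_add_of_nonneg_right (by positivity))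
  · push Not at h
    obtain ⟨z, hz, hz'⟩ := h
    refine (P.far hn x y hx hy).mono P.adm ?_
    have h1 := dist_add_dist_of_mem_segment hz
    rw [dist_eq_norm, dist_eq_norm] at h1
    have h2 : ‖(x : EuclideanSpace ℝ (Fin n))‖ - ‖z‖ ≤ _ := norm_sub_norm_le _ _
    have h3 : ‖(y : EuclideanSpace ℝ (Fin n))‖ - ‖z‖ ≤ _ := norm_sub_norm_le _ _
    rw [norm_sub_rev] at h3
    rw [Subtype.dist_eq, ← h1]
    have : (2 * C + 23) / (j:ℝ) = (2 * C + 20) / j + 3 / (2 * j) + 3 / (2 * j) := by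
      field_simp; ring
    rw [this]
    linarith

lemma Prof.exit (P : Prof j C f) (hn : 2 ≤ n) (x : Disk n)
    (hx : ‖(x : EuclideanSpace ℝ (Fin n))‖ ≤ 1 / (j:ℝ)) :
    ∃ b : Disk n, ‖(b : EuclideanSpace ℝ (Fin n))‖ = 1 / (j:ℝ) ∧
      E (gg n f) (1 - j * ‖(x : EuclideanSpace ℝ (Fin n))‖) x b := by
  obtain ⟨e, he, he3, e1, e2, e3⟩ := P.e
  obtain ⟨u, hu, h⟩ := exists_ray hn x
  have hm : 1 / (j:ℝ) ∈ Icc (0:ℝ) 1 := by rw [e1]; constructor <;> linarith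
  refine ⟨ray u hu _ hm, norm_ray _ _ _ _, ?_⟩
  have hd := dist_ray u hu _ _ (nm_mem x) hm
  rw [← h, abs_sub_comm, abs_of_nonneg (by linarith)] at hd
  have := P.seg x (ray u hu _ hm)
  have e4 : (j:ℝ) * (1 / j) = 1 := by rw [e1, e3]
  rw [hd, mul_sub, e4] at this
  exact this

lemma Prof.U_lr (P : Prof j C f) (hn : 2 ≤ n) (x y : Disk n)
    (hx : ‖(x : EuclideanSpace ℝ (Fin n))‖ ≤ 1 / (j:ℝ))
    (hy : 1 / (j:ℝ) ≤ ‖(y : EuclideanSpace ℝ (Fin n))‖) :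
    E (gg n f) (1 - j * ‖(x : EuclideanSpace ℝ (Fin n))‖ + ‖(y : EuclideanSpace ℝ (Fin n))‖ +
      (2 * C + 21) / j) x y := by
  obtain ⟨b, hb, h⟩ := P.exit hn x hx
  refine (h.trans P.adm (P.far hn b y hb.ge hy)).mono P.adm ?_
  rw [hb]; apply le_of_eq; ring

lemma Prof.U_ll (P : Prof j C f) (hn : 2 ≤ n) (x y : Disk n)
    (hx : ‖(x : EuclideanSpace ℝ (Fin n))‖ ≤ 1 / (j:ℝ))
    (hy : ‖(y : EuclideanSpace ℝ (Fin n))‖ ≤ 1 / (j:ℝ)) :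
    E (gg n f) (min (j * dist x y) (1 - j * ‖(x : EuclideanSpace ℝ (Fin n))‖ +
      (1 - j * ‖(y : EuclideanSpace ℝ (Fin n))‖)) + (2 * C + 22) / j) x y := by
  have hj := P.jpos
  have hC := P.hC
  rcases min_choice (j * dist x y) (1 - j * ‖(x : EuclideanSpace ℝ (Fin n))‖ +
      (1 - j * ‖(y : EuclideanSpace ℝ (Fin n))‖)) with h | h
  · rw [h]
    exact (P.seg x y).mono P.adm (le_add_of_nonneg_right (by positivity))
  · rw [h]
    obtain ⟨b, hb, h⟩ := P.exit hn y hy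
    refine ((P.U_lr hn x b hx hb.ge).trans P.adm h.symm).mono P.adm ?_
    rw [hb]; apply le_of_eq; ring

lemma Prof.hin (P : Prof j C f) (x : Disk n) (hx : ‖(x : EuclideanSpace ℝ (Fin n))‖ ≤ 1 / (j:ℝ)) :
    (j:ℝ) ≤ gg n f x := (P.a _ ⟨norm_nonneg _, hx⟩).ge

/-- radial test function -/
lemma Prof.psiR (P : Prof j C f) : ∃ ψ : Disk n → ℝ,
    (∀ x : Disk n, ‖(x : EuclideanSpace ℝ (Fin n))‖ ≤ 1 / (j:ℝ) →
      ψ x = j * ‖(x : EuclideanSpace ℝ (Fin n))‖) ∧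
    (∀ x : Disk n, 1 / (j:ℝ) ≤ ‖(x : EuclideanSpace ℝ (Fin n))‖ →
      ψ x = 1 + ‖(x : EuclideanSpace ℝ (Fin n))‖ - 1 / j) ∧
    ∀ p q : ℝ × Disk n, FutureRelated (fun _ => gg n f) p q →
      dist (ψ p.2) (ψ q.2) ≤ q.1 - p.1 := by
  obtain ⟨e, he, he3, e1, e2, e3⟩ := P.e
  have hj := P.jpos
  let ψ : Disk n → ℝ := fun x => if ‖(x : EuclideanSpace ℝ (Fin n))‖ ≤ 1 / (j:ℝ) then
    j * ‖(x : EuclideanSpace ℝ (Fin n))‖ else 1 + ‖(x : EuclideanSpace ℝ (Fin n))‖ - 1 / j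
  have h1 : ∀ x : Disk n, ‖(x : EuclideanSpace ℝ (Fin n))‖ ≤ 1 / (j:ℝ) →
      ψ x = j * ‖(x : EuclideanSpace ℝ (Fin n))‖ := fun x hx => if_pos hx
  have h2 : ∀ x : Disk n, 1 / (j:ℝ) ≤ ‖(x : EuclideanSpace ℝ (Fin n))‖ →
      ψ x = 1 + ‖(x : EuclideanSpace ℝ (Fin n))‖ - 1 / j := by
    intro x hx
    rcases hx.eq_or_lt with h | h
    · rw [h1 x h.ge, ← h, e1, e3]; ring
    · exact if_neg h.not_ge
  refine ⟨ψ, h1, h2, psi_cross hj P.adm P.hin ψ ?_ ?_ ?_⟩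
  · intro x y hx hy
    rw [h1 x hx, h1 y hy, ← mul_sub, abs_mul, abs_of_pos hj]
    gcongr
    exact norm_lip x y
  · intro x y hx hy
    rw [h2 x hx, h2 y hy]
    refine le_trans (le_of_eq ?_) (norm_lip x y)
    congr 1; ring
  · intro x y hx hy
    rw [h1 x hx.le, h1 y hy.le, hx, hy]

lemma Prof.psiL (P : Prof j C f) (x₀ : Disk n) : ∃ ψ : Disk n → ℝ,
    (∀ x : Disk n, ‖(x : EuclideanSpace ℝ (Fin n))‖ ≤ 1 / (j:ℝ) →
      ψ x = min (j * dist x₀ x) (1 - j * ‖(x₀ : EuclideanSpace ℝ (Fin n))‖ +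
      (1 - j * ‖(x : EuclideanSpace ℝ (Fin n))‖))) ∧
    ∀ p q : ℝ × Disk n, FutureRelated (fun _ => gg n f) p q →
      dist (ψ p.2) (ψ q.2) ≤ q.1 - p.1 := by
  obtain ⟨e, he, he3, e1, e2, e3⟩ := P.e
  have hj := P.jpos
  let ψ : Disk n → ℝ := fun x => if ‖(x : EuclideanSpace ℝ (Fin n))‖ ≤ 1 / (j:ℝ) then
    min (j * dist x₀ x) (1 - j * ‖(x₀ : EuclideanSpace ℝ (Fin n))‖ +
      (1 - j * ‖(x : EuclideanSpace ℝ (Fin n))‖)) else 1 - j * ‖(x₀ : EuclideanSpace ℝ (Fin n))‖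
  have h1 : ∀ x : Disk n, ‖(x : EuclideanSpace ℝ (Fin n))‖ ≤ 1 / (j:ℝ) →
      ψ x = min (j * dist x₀ x) (1 - j * ‖(x₀ : EuclideanSpace ℝ (Fin n))‖ +
      (1 - j * ‖(x : EuclideanSpace ℝ (Fin n))‖)) := fun x hx => if_pos hx
  have h2 : ∀ x : Disk n, 1 / (j:ℝ) ≤ ‖(x : EuclideanSpace ℝ (Fin n))‖ →
      ψ x = 1 - j * ‖(x₀ : EuclideanSpace ℝ (Fin n))‖ := by
    intro x hx
    rcases hx.eq_or_lt with h | h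
    · rw [h1 x h.ge, ← h, e1, e3, sub_self, add_zero]
      apply min_eq_right
      have h4 := norm_lip x₀ x
      rw [← h, e1, abs_sub_comm] at h4
      have h5 := (le_abs_self _).trans h4
      have h6 : (j:ℝ) * (e - ‖(x₀ : EuclideanSpace ℝ (Fin n))‖) ≤ j * dist x₀ x := by gcongr
      rw [mul_sub, e3] at h6
      exact h6
    · exact if_neg h.not_ge
  refine ⟨ψ, h1, psi_cross hj P.adm P.hin ψ ?_ ?_ ?_⟩
  · intro x y hx hy
    rw [h1 x hx, h1 y hy]
    refine min_lip ?_ ?_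
    · rw [← mul_sub, abs_mul, abs_of_pos hj]
      gcongr
      rw [dist_comm x₀ x, dist_comm x₀ y]; exact abs_dist_sub_le x y x₀
    · have : ∀ a b c d : ℝ, a + (1 - b * c) - (a + (1 - b * d)) = -(b * (c - d)) := by
        intros; ring
      rw [this, abs_neg, abs_mul, abs_of_pos hj]
      gcongr
      exact norm_lip x y
  · intro x y hx hy
    rw [h2 x hx, h2 y hy, sub_self, abs_zero]
    exact dist_nonneg
  · intro x y hx hy
    rw [h2 x hx.ge, h2 y hy.ge]

end prof
section final

variable {n j : ℕ} {C : ℝ} {f : ℝ → ℝ}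

lemma three_pts {V : Type*} [NormedAddCommGroup V] [InnerProductSpace ℝ V] {x y z : V}
    (hx : ‖x‖ ≤ 1) (hy : ‖y‖ ≤ 1) (hz : ‖z‖ ≤ 1) (h1 : 1.8 ≤ ‖x - y‖) (h2 : 1.8 ≤ ‖y - z‖)
    (h3 : 1.8 ≤ ‖x - z‖) : False := by
  have a1 := norm_sub_sq_real x y
  have a2 := norm_sub_sq_real y z
  have a3 := norm_sub_sq_real x z
  have a4 := norm_add_sq_real (x + y) z
  have a5 := norm_add_sq_real x y
  rw [inner_add_left] at a4
  have b1 : ‖x‖ ^ 2 ≤ 1 := by nlinarith [norm_nonneg x]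
  have b2 : ‖y‖ ^ 2 ≤ 1 := by nlinarith [norm_nonneg y]
  have b3 : ‖z‖ ^ 2 ≤ 1 := by nlinarith [norm_nonneg z]
  have c1 : (1.8:ℝ) ^ 2 ≤ ‖x - y‖ ^ 2 := by gcongr
  have c2 : (1.8:ℝ) ^ 2 ≤ ‖y - z‖ ^ 2 := by gcongr
  have c3 : (1.8:ℝ) ^ 2 ≤ ‖x - z‖ ^ 2 := by gcongr
  have d := sq_nonneg ‖x + y + z‖
  norm_num at c1 c2 c3
  linarith

lemma sandwich {nd T D l u ε : ℝ} (h1 : max T l ≤ nd) (h2 : nd ≤ max T u) (h3 : D - ε ≤ l)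
    (h4 : u ≤ D + ε) (hε : 0 ≤ ε) : |nd - max T D| ≤ ε := by
  rw [abs_le]
  constructor
  · have : max T D ≤ max T l + ε := max_le (by linarith [le_max_left T l])
      (by linarith [le_max_right T l])
    linarith
  · have : max T u ≤ max T D + ε := max_le (by linarith [le_max_left T D])
      (by linarith [le_max_right T D])
    linarith

/-- the correspondence -/
def Rel (n j : ℕ) : Set ((T01 × Disk n) × BubbleZ n) :=
  {p | (∃ (t : T01) (x ξ : Disk n), p = ((t, x), Sum.inl (t, ξ)) ∧
      (ξ : EuclideanSpace ℝ (Fin n)) = (j:ℝ) • (x : EuclideanSpace ℝ (Fin n)) ∧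
      ‖(x : EuclideanSpace ℝ (Fin n))‖ ≤ 1 / (j:ℝ)) ∨
    (∃ (t : T01) (x y : Disk n), p = ((t, x), Sum.inr (t, y)) ∧
      1 / (j:ℝ) ≤ ‖(x : EuclideanSpace ℝ (Fin n))‖ ∧ dist x y ≤ 3 / (j:ℝ))}

lemma Prof.scale (P : Prof j C f) {x : Disk n}
    (h : ‖(x : EuclideanSpace ℝ (Fin n))‖ ≤ 1 / (j:ℝ)) :
    (j:ℝ) • (x : EuclideanSpace ℝ (Fin n)) ∈ Metric.closedBall (0 : EuclideanSpace ℝ (Fin n)) 1 := by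
  have hj := P.jpos
  rw [mem_closedBall_zero_iff, norm_smul, Real.norm_eq_abs, abs_of_pos hj]
  calc (j:ℝ) * ‖(x : EuclideanSpace ℝ (Fin n))‖ ≤ j * (1 / j) := by gcongr
    _ = 1 := by field_simp

lemma Prof.rel_left (P : Prof j C f) (a : T01 × Disk n) : ∃ z, (a, z) ∈ Rel n j := by
  obtain ⟨t, x⟩ := a
  have hj := P.jpos
  rcases le_total ‖(x : EuclideanSpace ℝ (Fin n))‖ (1 / (j:ℝ)) with h | h
  · exact ⟨Sum.inl (t, ⟨_, P.scale h⟩), Or.inl ⟨t, x, _, rfl, rfl, h⟩⟩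
  · exact ⟨Sum.inr (t, x), Or.inr ⟨t, x, x, rfl, h, by rw [dist_self]; positivity⟩⟩

lemma Prof.rel_right (P : Prof j C f) (hn : 2 ≤ n) (z : BubbleZ n) : ∃ a, (a, z) ∈ Rel n j := by
  obtain ⟨e, he, he3, e1, e2, e3⟩ := P.e
  have hj := P.jpos
  rcases z with ⟨t, ξ⟩ | ⟨t, y⟩
  · have hle : ‖(1 / (j:ℝ)) • (ξ : EuclideanSpace ℝ (Fin n))‖ ≤ 1 / j := by
      rw [norm_smul, Real.norm_eq_abs, abs_of_pos (by positivity)]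
      exact mul_le_of_le_one_right (by positivity) (norm_disk ξ)
    refine ⟨(t, ⟨(1 / (j:ℝ)) • (ξ : EuclideanSpace ℝ (Fin n)), ?_⟩), Or.inl ⟨t, _, ξ, rfl, ?_, hle⟩⟩
    · rw [mem_closedBall_zero_iff]
      rw [e1] at hle ⊢; linarith
    · simp only
      rw [smul_smul, e1, e3, one_smul]
  · rcases le_total (1 / (j:ℝ)) ‖(y : EuclideanSpace ℝ (Fin n))‖ with h | h
    · exact ⟨(t, y), Or.inr ⟨t, y, y, rfl, h, by rw [dist_self]; positivity⟩⟩
    · obtain ⟨u, hu, _⟩ := exists_ray hn y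
      have hm : 1 / (j:ℝ) ∈ Icc (0:ℝ) 1 := by rw [e1]; constructor <;> linarith
      refine ⟨(t, ray u hu _ hm), Or.inr ⟨t, _, y, rfl, (norm_ray _ _ _ _).ge, ?_⟩⟩
      refine (dist_triangle _ (center n) _).trans ?_
      rw [dist_comm, dist_center, dist_center, norm_ray]
      have : 3 / (j:ℝ) = 3 * (1 / j) := by ring
      rw [this]
      linarith

lemma scale_norm {x ξ : Disk n}
    (h : (ξ : EuclideanSpace ℝ (Fin n)) = (j:ℝ) • (x : EuclideanSpace ℝ (Fin n))) :
    ‖(ξ : EuclideanSpace ℝ (Fin n))‖ = j * ‖(x : EuclideanSpace ℝ (Fin n))‖ := by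
  rw [h, norm_smul]; simp

lemma scale_dist {x ξ y η : Disk n}
    (h : (ξ : EuclideanSpace ℝ (Fin n)) = (j:ℝ) • (x : EuclideanSpace ℝ (Fin n)))
    (h' : (η : EuclideanSpace ℝ (Fin n)) = (j:ℝ) • (y : EuclideanSpace ℝ (Fin n))) :
    dist ξ η = j * dist x y := by
  rw [dist_disk, dist_disk, h, h', ← smul_sub, norm_smul]; simp

lemma Prof.close (P : Prof j C f) (hn : 2 ≤ n) {ε : ℝ} (hε : (2 * C + 40) / j ≤ ε)
    (a : (T01 × Disk n) × BubbleZ n) (ha : a ∈ Rel n j)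
    (b : (T01 × Disk n) × BubbleZ n) (hb : b ∈ Rel n j) :
    |nullDist (fun _ => gg n f) (fun p => p.1) 0 1 (emb a.1) (emb b.1)
      - bubbleQuotDist a.2 b.2| ≤ ε := by
  have hj := P.jpos
  have hC := P.hC
  have hc : ∀ k : ℝ, k ≤ 40 → (2 * C + k) / j ≤ ε := fun k hk => le_trans (by gcongr) hε
  have hc' : ∀ k : ℝ, k ≤ 40 → k / j ≤ ε := fun k hk =>
    le_trans (by gcongr; linarith) hε
  have hε0 : 0 ≤ ε := le_trans (by positivity) hε
  have s1 : ∀ k : ℝ, k / (j:ℝ) = k * (1 / j) := fun k => by ring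
  have s2 : ∀ k : ℝ, (2 * C + k) / (j:ℝ) = 2 * (C / j) + k * (1 / j) := fun k => by ring
  have s3 : 0 ≤ C / (j:ℝ) := by positivity
  have s4 : 0 ≤ 1 / (j:ℝ) := by positivity
  have s5 := hε
  rw [s2] at s5
  rcases ha with ⟨t, x, ξ, rfl, hξ, hx⟩ | ⟨t, x, ξ, rfl, hx, hd⟩ <;>
  rcases hb with ⟨s, y, η, rfl, hη, hy⟩ | ⟨s, y, η, rfl, hy, hd'⟩
  · rw [Q_ll hn, scale_norm hξ, scale_norm hη, scale_dist hξ hη]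
    obtain ⟨ψ, hψ, hF⟩ := P.psiL x
    have hE := P.U_ll hn x y hx hy
    refine sandwich (nd_lower P.adm t.2 s.2 hE ψ hF) (nd_upper P.adm t.2 s.2 hE) ?_
      (by linarith [hc 22 (by norm_num)]) hε0
    have hx1 : (j:ℝ) * ‖(x : EuclideanSpace ℝ (Fin n))‖ ≤ 1 := by
      rw [← scale_norm hξ]; exact norm_disk ξ
    rw [hψ x hx, hψ y hy, dist_self, mul_zero, min_eq_left (a := (0:ℝ)) (by linarith), Real.dist_eq,
      zero_sub, abs_neg]
    refine le_trans ?_ (le_abs_self _)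
    linarith
  · rw [Q_lr hn, scale_norm hξ]
    obtain ⟨ψ, hψ, hψ', hF⟩ := P.psiR (n := n)
    have hE := P.U_lr hn x y hx hy
    have hn' := (abs_le.1 ((norm_lip y η).trans hd'))
    rw [s1] at hn'
    refine sandwich (nd_lower P.adm t.2 s.2 hE ψ hF) (nd_upper P.adm t.2 s.2 hE) ?_
      (by rw [s2]; linarith [hn'.1, hn'.2]) hε0
    rw [hψ x hx, hψ' y hy, dist_comm, Real.dist_eq]
    refine le_trans ?_ (le_abs_self _)
    linarith [hn'.1, hn'.2]
  · rw [Q_rl hn, scale_norm hη]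
    obtain ⟨ψ, hψ, hψ', hF⟩ := P.psiR (n := n)
    have hE := (P.U_lr hn y x hy hx).symm
    have hn' := (abs_le.1 ((norm_lip x ξ).trans hd))
    rw [s1] at hn'
    refine sandwich (nd_lower P.adm t.2 s.2 hE ψ hF) (nd_upper P.adm t.2 s.2 hE) ?_
      (by rw [s2]; linarith [hn'.1, hn'.2]) hε0
    rw [hψ y hy, hψ' x hx, Real.dist_eq]
    refine le_trans ?_ (le_abs_self _)
    linarith [hn'.1, hn'.2]
  · rw [Q_rr]
    have hE := P.U_rr hn x y hx hy
    have t1 := dist_triangle4 x ξ η y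
    have t2 := dist_triangle4 ξ x y η
    rw [dist_comm η y] at t1
    rw [dist_comm ξ x] at t2
    rw [s1] at hd hd'
    refine sandwich (nd_lower P.adm t.2 s.2 hE id (psi_id P.adm)) (nd_upper P.adm t.2 s.2 hE) ?_
      (by rw [s2]; linarith) hε0
    simp only [id]
    linarith

lemma Prof.notclose (P : Prof j C f) (hn : 2 ≤ n) (hj10 : 10 ≤ j)
    (R : Set ((T01 × Disk n) × (T01 × Disk n))) (hR : ∀ x, ∃ y, (x, y) ∈ R)
    (h : ∀ a ∈ R, ∀ b ∈ R,
      |nullDist (fun _ => gg n f) (fun p => p.1) 0 1 (emb a.1) (emb b.1)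
      - dMink a.2 b.2| ≤ 1 / 10) : False := by
  obtain ⟨e, he, he3, e1, e2, e3⟩ := P.e
  have hj := P.jpos
  have h10 : (10:ℝ) ≤ j := by exact_mod_cast hj10
  have he10 : e ≤ 1 / 10 := by nlinarith
  obtain ⟨u, hu, _⟩ := exists_ray hn (center n)
  have hu' : ‖-u‖ = 1 := by rw [norm_neg, hu]
  have m1 : (1:ℝ) ∈ Icc (0:ℝ) 1 := by simp
  let o : T01 := ⟨0, by simp⟩
  let p := ray u hu 1 m1
  let q := ray (-u) hu' 1 m1
  have key : ∀ x y : Disk n, 1.9 ≤ nullDist (fun _ => gg n f) (fun p => p.1) 0 1 (emb (o, x)) (emb (o, y)) →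
      ∀ a b, ((o, x), a) ∈ R → ((o, y), b) ∈ R →
      1.8 ≤ ‖(a.2 : EuclideanSpace ℝ (Fin n)) - b.2‖ := by
    rintro x y hxy ⟨t, a⟩ ⟨s, b⟩ ha hb
    have h1 := (abs_le.1 (h _ ha _ hb)).2
    simp only at h1
    rw [dMink_eq] at h1
    have h2 : 1.8 ≤ max |(t:ℝ) - s| (dist a b) := by
      have : (1.8:ℝ) = 1.9 - 1 / 10 := by norm_num
      rw [this]; linarith
    rcases le_max_iff.1 h2 with h3 | h3
    · have : |(t:ℝ) - s| ≤ 1 := by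
        rw [abs_le]; constructor <;> linarith [t.2.1, t.2.2, s.2.1, s.2.2]
      norm_num at h3; linarith
    · rwa [dist_disk] at h3
  obtain ⟨ψ, hψ, hψ', hF⟩ := P.psiR (n := n)
  have rad : ∀ y : Disk n, ‖(y : EuclideanSpace ℝ (Fin n))‖ = 1 →
      1.9 ≤ nullDist (fun _ => gg n f) (fun p => p.1) 0 1 (emb (o, center n)) (emb (o, y)) := by
    intro y hy
    refine le_trans ?_ ((le_max_right _ _).trans
      (nd_lower P.adm o.2 o.2 (P.seg (center n) y) ψ hF))
    rw [hψ _ (by rw [norm_center]; positivity), hψ' y (by rw [hy, e1]; linarith), norm_center, hy,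
      dist_comm, Real.dist_eq, e1]
    refine le_trans ?_ (le_abs_self _)
    norm_num; linarith
  have hpq : 1.9 ≤ nullDist (fun _ => gg n f) (fun p => p.1) 0 1 (emb (o, p)) (emb (o, q)) := by
    refine le_trans ?_ ((le_max_right _ _).trans
      (nd_lower P.adm o.2 o.2 (P.seg p q) id (psi_id P.adm)))
    have : dist p q = 2 := by
      rw [dist_disk]
      simp only [p, q, ray]
      rw [one_smul, one_smul, sub_neg_eq_add, ← two_smul ℝ u, norm_smul, hu]; simp
    simp only [id, this]; norm_num
  obtain ⟨a, ha⟩ := hR (o, center n)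
  obtain ⟨b, hb⟩ := hR (o, p)
  obtain ⟨c, hc⟩ := hR (o, q)
  exact three_pts (norm_disk a.2) (norm_disk b.2) (norm_disk c.2)
    (key _ _ (rad p (norm_ray _ _ _ _)) a b ha hb) (key _ _ hpq b c hb hc)
    (key _ _ (rad q (norm_ray _ _ _ _)) a c ha hc)

end final

end NullDistPaper

/-- **Example 3.5 (`Ex-BlowUpBubble`): blow up producing a bubble.**
Let `(𝔻ⁿ,σ)`, `n ≥ 2`, be the flat disk and, for `j ≥ 2`, define `fⱼ`
radially by `fⱼ(r) = j` on `[0,1/j]`, decreasing with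
`∫_{1/j}^{3/(2j)} fⱼ ≤ C/j` on `[1/j, 3/(2j)]`, and `fⱼ(r) = 1` otherwise;
`gⱼ = -dt² + fⱼ²σ`, `g₀ = -dt² + σ`.  Then `(M, d̂_{t,gⱼ})` does not converge
to `([0,1] × 𝔻ⁿ, d̂_{t,g₀})`, but converges in the Gromov–Hausdorff sense to
the quotient `(P, d₀)` of `N₁ ⊔ N₂` (two copies of `([0,1] × 𝔻ⁿ, d̂_{t,g₀})`)
obtained by identifying `[0,1] × ∂𝔻ⁿ ⊆ N₁` with `[0,1] × {0} ⊆ N₂` by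
projection of the second factor. -/
theorem nullDist_blowup_bubble
    (n : ℕ) (hn : 2 ≤ n) (C : ℝ) (hC : 0 < C)
    (F : ℕ → ℝ → ℝ)
    (hFc : ∀ j : ℕ, 2 ≤ j → ContinuousOn (F j) (Set.Icc 0 1))
    (hFa : ∀ j : ℕ, 2 ≤ j → ∀ r ∈ Set.Icc (0:ℝ) (1 / (j:ℝ)), F j r = (j : ℝ))
    (hFm : ∀ j : ℕ, 2 ≤ j → AntitoneOn (F j) (Set.Icc (1 / (j:ℝ)) (3 / (2 * (j:ℝ)))))
    (hFb : ∀ j : ℕ, 2 ≤ j → ∀ r ∈ Set.Icc (3 / (2 * (j:ℝ))) 1, F j r = 1)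
    (hFone : ∀ j : ℕ, 2 ≤ j → ∀ r ∈ Set.Icc (0:ℝ) 1, 1 ≤ F j r)
    (hFint : ∀ j : ℕ, 2 ≤ j →
      (∫ r in (1 / (j:ℝ))..(3 / (2 * (j:ℝ))), F j r) ≤ C / (j:ℝ)) :
    -- `d̂_{t,gⱼ}` does not Gromov–Hausdorff converge to `([0,1] × 𝔻ⁿ, d̂_{t,g₀})`:
    ¬ GHConvergesTo
        (fun j (a b : T01 × Disk n) =>
          nullDist (fun _ (x : Disk n) => F j ‖(x : EuclideanSpace ℝ (Fin n))‖)
            (fun p => p.1) 0 1 (emb a) (emb b))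
        (dMink (n := n)) ∧
    -- but it Gromov–Hausdorff converges to the bubble space `(P, d₀)`:
    GHConvergesTo
      (fun j (a b : T01 × Disk n) =>
        nullDist (fun _ (x : Disk n) => F j ‖(x : EuclideanSpace ℝ (Fin n))‖)
          (fun p => p.1) 0 1 (emb a) (emb b))
      (bubbleQuotDist (n := n)) := by

  have hP : ∀ j : ℕ, 3 ≤ j → Prof j C (F j) := fun j hj =>
    ⟨hj, hC, hFc j (by omega), hFa j (by omega), hFm j (by omega), hFb j (by omega),
      hFone j (by omega), hFint j (by omega)⟩
  constructor
  · intro h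
    obtain ⟨N, hN⟩ := h (1 / 10) (by norm_num)
    obtain ⟨R, hR, _, hd⟩ := hN (max N 10) (le_max_left _ _)
    exact (hP _ (le_trans (by norm_num) (le_max_right N 10))).notclose hn (le_max_right _ _) R hR hd
  · intro ε hε
    obtain ⟨N, hN⟩ := exists_nat_ge ((2 * C + 40) / ε)
    refine ⟨max N 3, fun j hj => ?_⟩
    have P := hP j ((le_max_right _ _).trans hj)
    have hNj : (N:ℝ) ≤ j := by exact_mod_cast (le_max_left _ _).trans hj
    have hle : (2 * C + 40) / j ≤ ε := by
      rw [div_le_iff₀ P.jpos]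
      have := hN.trans hNj
      rw [div_le_iff₀ hε] at this
      linarith
    exact ⟨Rel n j, P.rel_left, P.rel_right hn, P.close hn hle⟩
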